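/- arXiv:1901.05367 — 2 statements merged into one kernel-verified Lean document; each statement's English description precedes it below -/
import Mathlib

section
/- Let Z_λ = N_λ + U where N_λ is Poisson with parameter λ > 0 and U is uniform on (0,1), independent. Denote by Me_{Z_λ} the median of Z_λ. Then, as λ → ∞, λ·(Me_{Z_λ} − λ − 1/3) − H(λ − ⌊λ⌋) → 0; equivalently Me_{Z_λ} = λ + 1/3 + H(λ − ⌊λ⌋)/λ + o(1/λ). -/
open MeasureTheory ProbabilityTheory Filter Real Set
open scoped ENNReal NNReal

/-- Distribution of `Z_λ = N_λ + U`, `N_λ` Poisson(λ), `U` uniform on `(0,1)`, independent. -/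
noncomputable def zMeasure (l : ℝ) : Measure ℝ :=
  Measure.map (fun p : ℝ × ℝ => p.1 + p.2)
    ((Measure.map (Nat.cast : ℕ → ℝ) (poissonMeasure l.toNNReal)).prod
      (volume.restrict (Set.Ioo (0 : ℝ) 1)))

/-- The median of `Z_λ`: `inf {t : P(Z_λ ≤ t) ≥ 1/2}`. -/
noncomputable def medianZ (l : ℝ) : ℝ :=
  sInf {t : ℝ | (1 : ℝ≥0∞) / 2 ≤ zMeasure l (Set.Iic t)}

/-- The function `H` of the main theorem. -/
noncomputable def Hfun (x : ℝ) : ℝ :=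
  if x ≤ 2 / 3 then x ^ 2 * (x - 1) / 3 + 4 / 135
  else x / 3 * (x ^ 2 - 4 * x + 5) - 86 / 135

/-- `w_n(x,k) = P(Z_{n+x} ≤ n + x + 1/3 + k/(n+x))`. -/
noncomputable def w (n : ℕ) (x k : ℝ) : ℝ :=
  (zMeasure (n + x) (Set.Iic ((n : ℝ) + x + 1 / 3 + k / (n + x)))).toReal

/-- `r_n(x,k) = k/(n+x)`. -/
noncomputable def r (n : ℕ) (x k : ℝ) : ℝ := k / (n + x)

/-- `g_n(u) = e^{-u} u^n`. -/
noncomputable def g (n : ℕ) (u : ℝ) : ℝ := Real.exp (-u) * u ^ n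

/-- `c_n(v,x) = ((n+v+x)/(n+1+x))^{n+1} e^{1-v}`. -/
noncomputable def c (n : ℕ) (v x : ℝ) : ℝ :=
  (((n : ℝ) + v + x) / ((n : ℝ) + 1 + x)) ^ (n + 1) * Real.exp (1 - v)

/-- `Δ_n(x,k) = ((n+1)!/g_{n+1}(n+1+x)) (w_{n+1}(x,k) - w_n(x,k))`. -/
noncomputable def Δfun (n : ℕ) (x k : ℝ) : ℝ :=
  ((n + 1).factorial : ℝ) / g (n + 1) ((n : ℝ) + 1 + x) * (w (n + 1) x k - w n x k)

open scoped Nat Topology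

/-- The Poisson probability `P(N_l = k)`. -/
noncomputable def poissonProb (k : ℕ) (l : ℝ) : ℝ := rexp (-l) * l ^ k / k !

/-- The Poisson distribution function `P(N_l ≤ n)`. -/
noncomputable def poissonCdf (n : ℕ) (l : ℝ) : ℝ :=
  ∑ k ∈ Finset.range (n + 1), poissonProb k l

lemma poissonMeasure_singleton_eq_ofReal {l : ℝ} (hl : 0 ≤ l) (k : ℕ) :
    poissonMeasure l.toNNReal {k} = ENNReal.ofReal (poissonProb k l) := by
  rw [poissonMeasure_singleton, poissonProb, Real.coe_toNNReal _ hl]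

lemma poissonMeasure_real_Iic {l : ℝ} (hl : 0 ≤ l) (n : ℕ) :
    (poissonMeasure l.toNNReal).real (Set.Iic n) = poissonCdf n l := by
  have h : Set.Iic n = ((Finset.range (n + 1) : Finset ℕ) : Set ℕ) := by
    ext k; simp
  rw [h, ← sum_measureReal_singleton]
  refine Finset.sum_congr rfl fun k _ => ?_
  rw [poissonMeasure_real_singleton, poissonProb, Real.coe_toNNReal _ hl]

/-- The centred and normalized Poisson distribution of parameter `n`. -/
noncomputable def poissonNormalized (n : ℕ) : Measure ℝ :=
  (Measure.map (Nat.cast : ℕ → ℝ) (poissonMeasure (n : ℝ).toNNReal)).map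
    (fun y => (√n)⁻¹ * (y - n))

instance (n : ℕ) : IsProbabilityMeasure (poissonNormalized n) := by
  have : IsProbabilityMeasure
      (Measure.map (Nat.cast : ℕ → ℝ) (poissonMeasure (n : ℝ).toNNReal)) :=
    Measure.isProbabilityMeasure_map (by fun_prop)
  exact Measure.isProbabilityMeasure_map (by fun_prop)

lemma charFun_poissonNormalized (n : ℕ) (t : ℝ) :
    charFun (poissonNormalized n) t =
      Complex.exp (n * (Complex.exp (((√n)⁻¹ * t : ℝ) * Complex.I) - 1
        - ((√n)⁻¹ * t : ℝ) * Complex.I)) := by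
  have h := charFun_map_cast_poissonMeasure (n : ℝ).toNNReal ((√n)⁻¹ * t)
  rw [charFun_apply] at h
  rw [poissonNormalized, charFun_apply, integral_map (by fun_prop) (by fun_prop)]
  have e : ∀ y : ℝ, Complex.exp ((inner ℝ ((√n)⁻¹ * (y - n)) t : ℝ) * Complex.I) =
      Complex.exp (-(n * (((√n)⁻¹ * t : ℝ) * Complex.I))) *
        Complex.exp ((inner ℝ y ((√n)⁻¹ * t) : ℝ) * Complex.I) := by
    intro y
    rw [← Complex.exp_add]
    simp only [Real.inner_apply]
    push_cast
    ring_nf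
  simp_rw [e]
  rw [integral_const_mul, h, ← Complex.exp_add]
  congr 1
  have : (((n : ℝ).toNNReal : ℝ) : ℂ) = n := by simp
  rw [this]
  ring

lemma tendsto_charFun_poissonNormalized (t : ℝ) :
    Tendsto (fun n => charFun (poissonNormalized n) t) atTop
      (𝓝 (charFun (gaussianReal 0 1) t)) := by
  simp_rw [charFun_poissonNormalized, charFun_gaussianReal]
  refine (Complex.continuous_exp.tendsto _).comp ?_
  have hs : Tendsto (fun n : ℕ => |(√n)⁻¹ * t|) atTop (𝓝 0) := by
    have : Tendsto (fun n : ℕ => (√n)⁻¹ * t) atTop (𝓝 0) := by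
      simpa using (tendsto_inv_atTop_zero.comp
        (Real.tendsto_sqrt_atTop.comp tendsto_natCast_atTop_atTop)).mul_const t
    simpa using this.abs
  rw [tendsto_iff_norm_sub_tendsto_zero]
  refine squeeze_zero' (g := fun n : ℕ => t ^ 2 * |(√n)⁻¹ * t|)
    (Eventually.of_forall fun n => norm_nonneg _) ?_ (by simpa using hs.const_mul (t ^ 2))
  filter_upwards [hs.eventually (gt_mem_nhds one_pos), eventually_gt_atTop 0] with n h1 hn
  set s : ℝ := (√n)⁻¹ * t with hs_def
  have hn' : (0 : ℝ) < n := by exact_mod_cast hn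
  have hns : (n : ℝ) * s ^ 2 = t ^ 2 := by
    rw [hs_def, mul_pow, inv_pow, Real.sq_sqrt hn'.le]; field_simp
  have hb := Complex.exp_bound (x := (s : ℂ) * Complex.I) (by simpa using h1.le) (n := 3) (by norm_num)
  simp only [Finset.sum_range_succ, Finset.sum_range_zero, Nat.factorial, norm_mul,
    Complex.norm_I, mul_one, Complex.norm_real, Real.norm_eq_abs] at hb
  have hI : ((s : ℂ) * Complex.I) ^ 2 = -(s : ℂ) ^ 2 := by rw [mul_pow, Complex.I_sq]; ring
  rw [hI] at hb
  have hnsC : (n : ℂ) * (s : ℂ) ^ 2 = (t : ℂ) ^ 2 := by exact_mod_cast hns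
  have e : (n : ℂ) * (Complex.exp ((s : ℂ) * Complex.I) - 1 - (s : ℂ) * Complex.I) -
      ((t : ℂ) * (0 : ℝ) * Complex.I - ((1 : ℝ≥0) : ℝ) * (t : ℂ) ^ 2 / 2) =
      n * (Complex.exp ((s : ℂ) * Complex.I) - (0 + ((s : ℂ) * Complex.I) ^ 0 / (1 : ℕ)
        + ((s : ℂ) * Complex.I) ^ 1 / ((0 + 1) * 1 : ℕ)
        + -(s : ℂ) ^ 2 / ((1 + 1) * ((0 + 1) * 1) : ℕ))) := by
    rw [← hnsC]; push_cast; ring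
  rw [e, norm_mul, Complex.norm_natCast]
  calc _ ≤ (n : ℝ) * (|s| ^ 3 * 1) := by
        gcongr
        refine hb.trans ?_
        gcongr
        norm_num
    _ = t ^ 2 * |s| := by
        rw [← hns, ← sq_abs s]; ring

lemma gaussianReal_Iic_zero : gaussianReal 0 1 (Set.Iic (0 : ℝ)) = 1 / 2 := by
  have hna : NullSingletonClass (gaussianReal 0 1) := nullSingletonClass_gaussianReal (by simp)
  have h1 : gaussianReal 0 1 (Set.Ici (0 : ℝ)) = gaussianReal 0 1 (Set.Iic (0 : ℝ)) := by
    conv_lhs => rw [← neg_zero, ← gaussianReal_map_neg]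
    rw [Measure.map_apply (by fun_prop) measurableSet_Ici]
    congr 1
    ext x; simp
  have h2 : gaussianReal 0 1 (Set.Iic (0 : ℝ)) + gaussianReal 0 1 (Set.Ioi (0 : ℝ)) = 1 := by
    rw [← Set.compl_Iic]
    exact prob_add_prob_compl measurableSet_Iic
  rw [measure_congr Ioi_ae_eq_Ici, h1, ← two_mul] at h2
  rw [ENNReal.eq_div_iff (by norm_num) (by norm_num), h2]

/-- The central limit theorem at the centre: `P(N_n ≤ n) → 1/2`. -/
lemma tendsto_poissonCdf_self : Tendsto (fun n : ℕ => poissonCdf n n) atTop (𝓝 (1 / 2)) := by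
  let P : ℕ → ProbabilityMeasure ℝ := fun n => ⟨poissonNormalized n, inferInstance⟩
  let G : ProbabilityMeasure ℝ := ⟨gaussianReal 0 1, inferInstance⟩
  have hw : Tendsto P atTop (𝓝 G) :=
    ProbabilityMeasure.tendsto_iff_tendsto_charFun.2 tendsto_charFun_poissonNormalized
  have hna : NullSingletonClass (gaussianReal 0 1) := nullSingletonClass_gaussianReal (by simp)
  have h := ProbabilityMeasure.tendsto_measure_of_null_frontier_of_tendsto' hw
    (E := Set.Iic (0 : ℝ)) (by simp [G])
  have h' := (ENNReal.tendsto_toReal (by simp [G, gaussianReal_Iic_zero])).comp h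
  simp only [G, ProbabilityMeasure.coe_mk, gaussianReal_Iic_zero] at h'
  have e : (1 / 2 : ℝ≥0∞).toReal = 1 / 2 := by simp
  rw [e] at h'
  refine h'.congr' ?_
  filter_upwards [eventually_gt_atTop 0] with n hn
  have hn' : (0 : ℝ) < n := by exact_mod_cast hn
  rw [← poissonMeasure_real_Iic hn'.le, measureReal_def]
  simp only [Function.comp, P, ProbabilityMeasure.coe_mk, poissonNormalized]
  rw [Measure.map_apply (by fun_prop) measurableSet_Iic,
    Measure.map_apply (by fun_prop) (measurableSet_Iic.preimage (by fun_prop))]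
  congr 2
  ext k
  have : 0 < (√(n : ℝ))⁻¹ := by positivity
  simp [mul_nonpos_iff_pos_imp_nonpos, this, this.le]

lemma poissonProb_pos {l : ℝ} (hl : 0 < l) (k : ℕ) : 0 < poissonProb k l := by
  unfold poissonProb; positivity

/-- The ratio `P(N_{n+s} = n) / P(N_n = n)`. -/
noncomputable def poissonRatio (n : ℕ) (s : ℝ) : ℝ := rexp (-s) * (1 + s / n) ^ n

lemma poissonProb_add {n : ℕ} (hn : n ≠ 0) (s : ℝ) :
    poissonProb n (n + s) = poissonProb n n * poissonRatio n s := by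
  have hn' : (n : ℝ) ≠ 0 := by exact_mod_cast hn
  have h : (n : ℝ) + s = n * (1 + s / n) := by field_simp
  rw [poissonProb, poissonProb, poissonRatio, show -((n : ℝ) + s) = -n + -s by ring, Real.exp_add,
    h, mul_pow]
  ring

lemma poissonProb_succ_self (n : ℕ) :
    poissonProb (n + 1) ((n + 1 : ℕ) : ℝ) = poissonProb n ((n : ℝ) + 1) := by
  rw [poissonProb, poissonProb, Nat.factorial_succ]
  push_cast
  field_simp
  ring

lemma abs_poissonRatio_sub_le {n : ℕ} (hn : 2 ≤ n) {s : ℝ} (h0 : 0 ≤ s) (h1 : s ≤ 1) :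
    |poissonRatio n s - (1 - s ^ 2 / (2 * n) + s ^ 3 / (3 * n ^ 2) + s ^ 4 / (8 * n ^ 2))| ≤
      (10 : ℝ) / n ^ 3 := by
  have hn2 : (2 : ℝ) ≤ n := by exact_mod_cast hn
  have hn0 : (0 : ℝ) < n := by linarith
  obtain ⟨h, hh⟩ : ∃ h : ℝ, h = 1 / n := ⟨_, rfl⟩
  have hh0 : 0 < h := by rw [hh]; positivity
  have hh2 : h ≤ 1 / 2 := by rw [hh]; gcongr
  have hnh : n * h = 1 := by rw [hh]; field_simp
  have hsh0 : 0 ≤ s * h := by positivity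
  have hshh : s * h ≤ h := by nlinarith
  set z : ℝ := n * Real.log (1 + s * h) - s with hz
  have hρ : poissonRatio n s = rexp z := by
    have h1s : s / n = s * h := by rw [hh]; ring
    rw [poissonRatio, hz, sub_eq_add_neg, Real.exp_add, mul_comm (n : ℝ), Real.exp_mul,
      Real.exp_log (by linarith), Real.rpow_natCast, h1s, mul_comm]
  have hlog := Real.abs_log_sub_add_sum_range_le (x := -(s * h)) (by
    rw [abs_neg, abs_of_nonneg hsh0]; linarith) 3
  rw [abs_neg, abs_of_nonneg hsh0] at hlog
  simp only [Finset.sum_range_succ, Finset.sum_range_zero, sub_neg_eq_add] at hlog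
  have hlog2 : (s * h) ^ (3 + 1) / (1 - s * h) ≤ 2 * h ^ 4 := by
    rw [div_le_iff₀ (by linarith)]
    have : (s * h) ^ (3 + 1) ≤ h ^ 4 := by gcongr
    have h2 : 0 ≤ h ^ 4 * (1 / 2 - s * h) :=
      mul_nonneg (by positivity) (by linarith)
    linarith
  have he : |z + s ^ 2 * h / 2 - s ^ 3 * h ^ 2 / 3| ≤ 2 * h ^ 3 := by
    have e : z + s ^ 2 * h / 2 - s ^ 3 * h ^ 2 / 3 =
        n * (0 + (-(s * h)) ^ (0 + 1) / ((0 : ℕ) + 1) + (-(s * h)) ^ (1 + 1) / ((1 : ℕ) + 1)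
          + (-(s * h)) ^ (2 + 1) / ((2 : ℕ) + 1) + Real.log (1 + s * h)) := by
      rw [hz]
      push_cast
      linear_combination (-s + s ^ 2 * h / 2 - s ^ 3 * h ^ 2 / 3) * (-hnh)
    rw [e, abs_mul, abs_of_pos hn0]
    calc _ ≤ n * (2 * h ^ 4) := by gcongr; exact hlog.trans hlog2
      _ = 2 * h ^ 3 := by linear_combination 2 * h ^ 3 * hnh
  have hs2 : s ^ 2 ≤ 1 := pow_le_one₀ h0 h1
  have hs3 : s ^ 3 ≤ 1 := pow_le_one₀ h0 h1
  have hh3 : h ^ 3 ≤ h ^ 2 / 2 := by nlinarith [sq_nonneg h]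
  have hh22 : h ^ 2 ≤ h / 2 := by nlinarith
  have k1 : 0 ≤ s ^ 2 * h := by positivity
  have k2 : s ^ 2 * h ≤ h := by nlinarith
  have k3 : 0 ≤ s ^ 3 * h ^ 2 := by positivity
  have k4 : s ^ 3 * h ^ 2 ≤ h ^ 2 := by nlinarith [sq_nonneg h]
  obtain ⟨he1, he2⟩ := abs_le.1 he
  have hzb : |z| ≤ 2 * h := abs_le.2 ⟨by linarith, by linarith⟩
  have hexp := Real.exp_bound (x := z) (by linarith) (n := 3) (by norm_num)
  simp only [Finset.sum_range_succ, Finset.sum_range_zero, Nat.factorial] at hexp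
  have hexp2 : |z| ^ 3 * (((3 : ℕ).succ : ℝ) / (((2 + 1) * ((1 + 1) * ((0 + 1) * 1)) : ℕ) * (3 : ℕ)))
      ≤ 2 * h ^ 3 := by
    calc _ ≤ (2 * h) ^ 3 * (1 / 4) := by
          refine mul_le_mul (pow_le_pow_left₀ (abs_nonneg z) hzb 3) (by norm_num) (by positivity)
            (by positivity)
      _ = _ := by ring
  have hq : |(z + s ^ 2 * h / 2) * (z - s ^ 2 * h / 2)| ≤ (2 * h ^ 2) * (3 * h) := by
    rw [abs_mul]
    gcongr
    · exact abs_le.2 ⟨by linarith, by linarith⟩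
    · exact abs_le.2 ⟨by linarith, by linarith⟩
  have hgoal : (10 : ℝ) / n ^ 3 = 10 * h ^ 3 := by rw [hh]; field_simp
  have hpoly : 1 - s ^ 2 / (2 * n) + s ^ 3 / (3 * n ^ 2) + s ^ 4 / (8 * n ^ 2) =
      1 - s ^ 2 * h / 2 + s ^ 3 * h ^ 2 / 3 + s ^ 4 * h ^ 2 / 8 := by
    rw [hh]; field_simp
  rw [hgoal, hpoly, hρ]
  have hexp3 := hexp.trans hexp2
  push_cast at hexp3
  obtain ⟨e1, e2⟩ := abs_le.1 hexp3
  obtain ⟨q1, q2⟩ := abs_le.1 hq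
  have hh30 : 0 < h ^ 3 := by positivity
  refine abs_le.2 ⟨?_, ?_⟩ <;> ring_nf at * <;> linarith

lemma hasDerivAt_poissonCdf (n : ℕ) (l : ℝ) :
    HasDerivAt (poissonCdf n) (-poissonProb n l) l := by
  have he : HasDerivAt (fun l : ℝ => rexp (-l)) (-rexp (-l)) l := by
    simpa using (hasDerivAt_neg l).exp
  induction n with
  | zero =>
    have : poissonCdf 0 = fun l => rexp (-l) := by
      ext l; simp [poissonCdf, poissonProb]
    rw [this]
    simpa [poissonProb] using he
  | succ n ih =>
    have : poissonCdf (n + 1) = fun l => poissonCdf n l + poissonProb (n + 1) l := by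
      ext l; rw [poissonCdf, Finset.sum_range_succ, poissonCdf]
    rw [this]
    have hp : HasDerivAt (poissonProb (n + 1)) (poissonProb n l - poissonProb (n + 1) l) l := by
      have := (he.mul (hasDerivAt_pow (n + 1) l)).div_const ((n + 1)! : ℝ)
      refine this.congr_deriv ?_
      rw [poissonProb, poissonProb, Nat.factorial_succ]
      push_cast
      field_simp
      ring
    exact (ih.add hp).congr_deriv (by ring)

lemma abs_poissonCdf_add_sub_le {n : ℕ} (hn : 2 ≤ n) {s : ℝ} (h0 : 0 ≤ s) (h1 : s ≤ 1) :
    |poissonCdf n (n + s) - poissonCdf n n + poissonProb n n *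
      (s - s ^ 3 / (6 * n) + s ^ 4 / (12 * n ^ 2) + s ^ 5 / (40 * n ^ 2))| ≤
      poissonProb n n * (10 / n ^ 3) := by
  have hn0 : (0 : ℝ) < n := by positivity
  have hp := poissonProb_pos hn0 n
  set f : ℝ → ℝ := fun s => poissonCdf n (n + s) + poissonProb n n *
      (s - s ^ 3 / (6 * n) + s ^ 4 / (12 * n ^ 2) + s ^ 5 / (40 * n ^ 2)) with hf
  have hd : ∀ t ∈ Set.Icc (0 : ℝ) 1, HasDerivWithinAt f (-(poissonProb n n * (poissonRatio n t -
      (1 - t ^ 2 / (2 * n) + t ^ 3 / (3 * n ^ 2) + t ^ 4 / (8 * n ^ 2))))) (Set.Icc 0 1) t := by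
    intro t _
    have d1 : HasDerivAt (fun s => poissonCdf n (n + s)) (-poissonProb n (n + t)) t :=
      (hasDerivAt_poissonCdf n (n + t)).comp_const_add (n : ℝ) t
    have d2 := (((hasDerivAt_id t).sub ((hasDerivAt_pow 3 t).div_const (6 * (n : ℝ)))).add
      ((hasDerivAt_pow 4 t).div_const (12 * (n : ℝ) ^ 2))).add
      ((hasDerivAt_pow 5 t).div_const (40 * (n : ℝ) ^ 2))
    refine ((d1.add (d2.const_mul (poissonProb n n))).congr_deriv ?_).hasDerivWithinAt
    rw [poissonProb_add (by positivity)]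
    push_cast
    field_simp
    ring
  have := Convex.norm_image_sub_le_of_norm_hasDerivWithin_le hd
    (C := poissonProb n n * (10 / n ^ 3)) (fun t ht => by
      rw [norm_neg, norm_mul, Real.norm_of_nonneg hp.le]
      gcongr
      exact abs_poissonRatio_sub_le hn ht.1 ht.2) (convex_Icc _ _)
      (Set.left_mem_Icc.2 zero_le_one) (Set.mem_Icc.2 ⟨h0, h1⟩)
  rw [Real.norm_eq_abs, Real.norm_eq_abs, sub_zero, abs_of_nonneg h0] at this
  have e : f s - f 0 = poissonCdf n (n + s) - poissonCdf n n + poissonProb n n *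
      (s - s ^ 3 / (6 * n) + s ^ 4 / (12 * n ^ 2) + s ^ 5 / (40 * n ^ 2)) := by
    simp [hf]; ring
  rw [← e]
  exact this.trans (mul_le_of_le_one_right (by positivity) h1)

/-- The quantity whose distance to `1/2` is of lower order than `P(N_n = n) / n`. -/
noncomputable def ramanujanSeq (n : ℕ) : ℝ :=
  poissonCdf n n - (2 / 3 - 4 / (135 * n)) * poissonProb n n

lemma abs_ramanujanSeq_succ_sub_le {n : ℕ} (hn : 2 ≤ n) :
    |ramanujanSeq (n + 1) - ramanujanSeq n| ≤ 20 * poissonProb n n / n ^ 3 := by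
  have hn2 : (2 : ℝ) ≤ n := by exact_mod_cast hn
  have hn0 : (0 : ℝ) < n := by linarith
  have hp := poissonProb_pos hn0 n
  have hc := abs_poissonCdf_add_sub_le hn zero_le_one le_rfl
  have hr := abs_poissonRatio_sub_le hn zero_le_one le_rfl
  have hs : poissonCdf (n + 1) ((n + 1 : ℕ) : ℝ) =
      poissonCdf n (n + 1) + poissonProb n n * poissonRatio n 1 := by
    rw [poissonCdf, Finset.sum_range_succ, poissonProb_succ_self, poissonProb_add (by positivity),
      poissonCdf]
    push_cast; rfl
  set q := poissonProb n n with hq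
  set R := poissonRatio n 1 with hR
  have hm0 : (0 : ℝ) < n + 1 := by linarith
  have e : ramanujanSeq (n + 1) - ramanujanSeq n =
      (poissonCdf n (n + 1) - poissonCdf n n + q *
      (1 - 1 ^ 3 / (6 * n) + 1 ^ 4 / (12 * n ^ 2) + 1 ^ 5 / (40 * n ^ 2))) +
      q * ((1 / 3 + 4 / (135 * (n + 1))) *
        (R - (1 - 1 ^ 2 / (2 * n) + 1 ^ 3 / (3 * n ^ 2) + 1 ^ 4 / (8 * n ^ 2)))) +
      q * (47 / 810 / (n ^ 2 * (n + 1))) := by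
    rw [ramanujanSeq, ramanujanSeq, hs, poissonProb_succ_self, poissonProb_add (by positivity),
      ← hq, ← hR]
    push_cast
    field_simp
    ring
  have h1 : (47 / 810 / (n ^ 2 * (n + 1)) : ℝ) ≤ 1 / n ^ 3 := by
    rw [div_div, div_le_div_iff₀ (by positivity) (by positivity)]
    nlinarith [pow_pos hn0 3, pow_pos hn0 2]
  have h2 : (1 / 3 + 4 / (135 * (n + 1)) : ℝ) ≤ 1 / 2 := by
    have : (4 / (135 * (n + 1)) : ℝ) ≤ 4 / (135 * 1) := by gcongr; linarith
    linarith
  rw [e]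
  refine (abs_add_le _ _).trans ((add_le_add_left (abs_add_le _ _) _).trans ?_)
  rw [abs_mul q, abs_mul q, abs_mul (1 / 3 + _), abs_of_pos hp,
    abs_of_pos (by positivity : (0 : ℝ) < 1 / 3 + 4 / (135 * (n + 1))),
    abs_of_pos (by positivity : (0 : ℝ) < 47 / 810 / (n ^ 2 * (n + 1)))]
  calc _ ≤ q * (10 / n ^ 3) + q * (1 / 2 * (10 / n ^ 3)) + q * (1 / n ^ 3) := by gcongr
    _ = 16 * q / n ^ 3 := by ring
    _ ≤ 20 * q / n ^ 3 := by gcongr; norm_num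

lemma poissonRatio_one_le {n : ℕ} (hn : n ≠ 0) : poissonRatio n 1 ≤ 1 := by
  have hn0 : (0 : ℝ) < n := by positivity
  have h : (1 + 1 / (n : ℝ)) ^ n ≤ rexp 1 := by
    calc (1 + 1 / (n : ℝ)) ^ n ≤ rexp (1 / n) ^ n := by
          gcongr; rw [add_comm]; exact Real.add_one_le_exp _
      _ = rexp 1 := by rw [← Real.exp_nat_mul]; congr 1; field_simp
  calc poissonRatio n 1 ≤ rexp (-1) * rexp 1 := by unfold poissonRatio; gcongr
    _ = 1 := by rw [← Real.exp_add]; simp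

lemma poissonProb_succ_self_le {n : ℕ} (hn : n ≠ 0) :
    poissonProb (n + 1) ((n + 1 : ℕ) : ℝ) ≤ poissonProb n n := by
  rw [poissonProb_succ_self, poissonProb_add hn]
  exact mul_le_of_le_one_right (poissonProb_pos (by positivity) n).le (poissonRatio_one_le hn)

lemma tendsto_poissonProb_self : Tendsto (fun n : ℕ => poissonProb n n) atTop (𝓝 0) := by
  have hs : Tendsto (fun n : ℕ => (√(n : ℝ))⁻¹) atTop (𝓝 0) :=
    tendsto_inv_atTop_zero.comp (Real.tendsto_sqrt_atTop.comp tendsto_natCast_atTop_atTop)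
  refine squeeze_zero' ?_ ?_ hs
  · filter_upwards [eventually_gt_atTop 0] with n hn
    exact (poissonProb_pos (by positivity) n).le
  · filter_upwards [eventually_gt_atTop 0] with n hn
    have hn0 : (0 : ℝ) < n := by positivity
    have h := Stirling.le_factorial_stirling n
    have h2 : √(n : ℝ) * (n / rexp 1) ^ n ≤ n ! := by
      refine le_trans ?_ h
      gcongr
      nlinarith [Real.pi_gt_three]
    have h3 : (n / rexp 1) ^ n = rexp (-n) * (n : ℝ) ^ n := by
      rw [div_pow, ← Real.exp_nat_mul, mul_one, Real.exp_neg, div_eq_inv_mul]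
    rw [poissonProb, div_le_iff₀ (by positivity), ← h3, le_inv_mul_iff₀ (by positivity)]
    exact h2

lemma tendsto_ramanujanSeq : Tendsto ramanujanSeq atTop (𝓝 (1 / 2)) := by
  have h : Tendsto (fun n : ℕ => 2 / 3 - 4 / (135 * (n : ℝ))) atTop (𝓝 (2 / 3 - 0)) :=
    tendsto_const_nhds.sub (Tendsto.const_div_atTop
      (tendsto_natCast_atTop_atTop.const_mul_atTop (by norm_num)) _)
  have h' := tendsto_poissonCdf_self.sub (h.mul tendsto_poissonProb_self)
  rw [mul_zero, sub_zero] at h'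
  exact h'

/-- Ramanujan's expansion of the median of a Poisson distribution with integer parameter. -/
lemma abs_ramanujanSeq_sub_half_le {n : ℕ} (hn : 2 ≤ n) :
    |ramanujanSeq n - 1 / 2| ≤ 40 * poissonProb n n / n ^ 2 := by
  have hn0 : (0 : ℝ) < n := by positivity
  have hp := poissonProb_pos hn0 n
  have key : ∀ m, n ≤ m → poissonProb m m ≤ poissonProb n n ∧
      |ramanujanSeq n - ramanujanSeq m| ≤
        20 * poissonProb n n * (2 / (n : ℝ) ^ 2 - 2 / (m : ℝ) ^ 2) := by
    intro m hm
    induction m, hm using Nat.le_induction with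
    | base => simp
    | succ m hm ih =>
      have hm0 : (0 : ℝ) < m := by have : 0 < m := by omega
                                   positivity
      refine ⟨(poissonProb_succ_self_le (by omega)).trans ih.1, ?_⟩
      have h1 := abs_ramanujanSeq_succ_sub_le (hn.trans hm)
      have h2 : 20 * poissonProb m m / (m : ℝ) ^ 3 ≤
          20 * poissonProb n n * (2 / (m : ℝ) ^ 2 - 2 / ((m + 1 : ℕ) : ℝ) ^ 2) := by
        rw [mul_div_assoc, mul_assoc]
        have h3 : 1 / (m : ℝ) ^ 3 ≤ 2 / (m : ℝ) ^ 2 - 2 / ((m + 1 : ℕ) : ℝ) ^ 2 := by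
          push_cast
          rw [div_sub_div _ _ (by positivity) (by positivity),
            div_le_div_iff₀ (by positivity) (by positivity)]
          have hm1 : (1 : ℝ) ≤ m := by exact_mod_cast (by omega : 1 ≤ m)
          have : 0 ≤ (m : ℝ) ^ 2 * (3 * m ^ 2 - 1) := mul_nonneg (by positivity) (by nlinarith)
          nlinarith
        calc 20 * (poissonProb m m / (m : ℝ) ^ 3) = 20 * (poissonProb m m * (1 / (m : ℝ) ^ 3)) := by
              ring
          _ ≤ _ := by
              gcongr
              exact ih.1
      calc |ramanujanSeq n - ramanujanSeq (m + 1)|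
          ≤ |ramanujanSeq n - ramanujanSeq m| + |ramanujanSeq m - ramanujanSeq (m + 1)| :=
            abs_sub_le _ _ _
        _ ≤ _ := by
            rw [abs_sub_comm (ramanujanSeq m)]
            linarith [ih.2]
  refine le_of_tendsto (tendsto_ramanujanSeq.const_sub (ramanujanSeq n)).abs ?_
  filter_upwards [eventually_ge_atTop n] with m hm
  refine (key m hm).2.trans ?_
  have : 0 ≤ 20 * poissonProb n n * (2 / (m : ℝ) ^ 2) := by positivity
  calc _ ≤ 20 * poissonProb n n * (2 / (n : ℝ) ^ 2) := by linarith
    _ = _ := by ring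

lemma volume_restrict_Ioo_Iic (y : ℝ) :
    (volume.restrict (Set.Ioo (0 : ℝ) 1)) (Set.Iic y) = ENNReal.ofReal (min y 1) := by
  rw [Measure.restrict_apply measurableSet_Iic]
  rcases le_or_gt 1 y with h | h
  · have : Set.Iic y ∩ Set.Ioo (0 : ℝ) 1 = Set.Ioo 0 1 :=
      Set.inter_eq_right.2 fun u hu => (hu.2.le.trans h : u ≤ y)
    rw [this, min_eq_right h]
    simp
  · have : Set.Iic y ∩ Set.Ioo (0 : ℝ) 1 = Set.Ioc 0 y := by
      ext u
      simp only [Set.mem_inter_iff, Set.mem_Iic, Set.mem_Ioo, Set.mem_Ioc]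
      exact ⟨fun hu => ⟨hu.2.1, hu.1⟩, fun hu => ⟨hu.2, hu.1, hu.2.trans_lt h⟩⟩
    rw [this, min_eq_left h.le]
    simp

lemma zMeasure_Iic {l : ℝ} (hl : 0 ≤ l) (t : ℝ) :
    zMeasure l (Set.Iic t) =
      ∑' k : ℕ, ENNReal.ofReal (poissonProb k l) * ENNReal.ofReal (min (t - k) 1) := by
  rw [zMeasure, Measure.map_apply (by fun_prop) measurableSet_Iic,
    Measure.prod_apply (measurableSet_Iic.preimage (by fun_prop)),
    lintegral_map (measurable_measure_prodMk_left (measurableSet_Iic.preimage (by fun_prop)))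
      (by fun_prop)]
  have e : ∀ k : ℕ, (volume.restrict (Set.Ioo (0 : ℝ) 1))
      (Prod.mk (k : ℝ) ⁻¹' ((fun p : ℝ × ℝ => p.1 + p.2) ⁻¹' Set.Iic t)) =
      ENNReal.ofReal (min (t - k) 1) := by
    intro k
    rw [← volume_restrict_Ioo_Iic]
    congr 1
    ext u
    simp [le_sub_iff_add_le']
  simp_rw [e]
  rw [lintegral_countable']
  refine tsum_congr fun k => ?_
  rw [poissonMeasure_singleton_eq_ofReal hl, mul_comm]

/-- The distribution function of `Z_l` on `[n, n + 2]`. -/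
lemma zMeasure_Iic_add {l : ℝ} (hl : 0 < l) (n : ℕ) {v : ℝ} (h0 : 0 ≤ v) (h2 : v ≤ 2) :
    zMeasure l (Set.Iic (n + v)) = ENNReal.ofReal (poissonCdf n l + (v - 1) * poissonProb n l
      + max (v - 1) 0 * (poissonProb (n + 1) l - poissonProb n l)) := by
  have hp := fun k => (poissonProb_pos hl k).le
  rw [zMeasure_Iic hl.le, tsum_eq_sum (s := Finset.range (n + 1 + 1))]
  · have h : ∀ k ∈ Finset.range (n + 1 + 1),
        ENNReal.ofReal (poissonProb k l) * ENNReal.ofReal (min (n + v - k) 1) =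
        ENNReal.ofReal (poissonProb k l * max 0 (min (n + v - k) 1)) := by
      intro k _
      rw [ENNReal.ofReal_mul (hp k)]
      simp
    rw [Finset.sum_congr rfl h, ← ENNReal.ofReal_sum_of_nonneg
      (fun k _ => mul_nonneg (hp k) (le_max_left _ _))]
    congr 1
    rw [Finset.sum_range_succ, Finset.sum_range_succ, poissonCdf, Finset.sum_range_succ]
    have h' : ∀ k ∈ Finset.range n,
        poissonProb k l * max 0 (min (n + v - k) 1) = poissonProb k l := by
      intro k hk
      have : ((k + 1 : ℕ) : ℝ) ≤ n := by exact_mod_cast Finset.mem_range.1 hk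
      push_cast at this
      rw [min_eq_right (by linarith), max_eq_right zero_le_one, mul_one]
    rw [Finset.sum_congr rfl h']
    push_cast
    rcases le_total v 1 with hv | hv
    · rw [max_eq_right (by linarith : v - 1 ≤ 0), min_eq_left (by linarith),
        max_eq_right (by linarith), min_eq_left (by linarith), max_eq_left (by linarith)]
      ring
    · rw [max_eq_left (by linarith : 0 ≤ v - 1), min_eq_right (by linarith),
        max_eq_right (by linarith), min_eq_left (by linarith), max_eq_right (by linarith)]
      ring
  · intro k hk
    have : ((n + 1 + 1 : ℕ) : ℝ) ≤ k := by
      exact_mod_cast not_lt.1 (fun h => hk (Finset.mem_range.2 h))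
    push_cast at this
    rw [min_eq_left (by linarith), ENNReal.ofReal_of_nonpos (by linarith : (n : ℝ) + v - k ≤ 0),
      mul_zero]

lemma Hfun_eq (x : ℝ) :
    Hfun x = x ^ 2 * (x - 1) / 3 + 4 / 135 + max (x - 2 / 3) 0 * (1 - x) := by
  unfold Hfun
  split_ifs with h
  · rw [max_eq_right (by linarith)]; ring
  · rw [max_eq_left (by linarith)]; ring

lemma abs_Hfun_le {x : ℝ} (h0 : 0 ≤ x) (h1 : x ≤ 1) : |Hfun x| ≤ 1 / 2 := by
  have hm : max (x - 2 / 3) 0 ≤ 1 / 3 := max_le (by linarith) (by norm_num)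
  have hm0 : 0 ≤ max (x - 2 / 3) 0 := le_max_right _ _
  have a1 : x ^ 2 * (1 - x) ≤ 1 / 4 := by nlinarith [sq_nonneg (x - 1 / 2), mul_nonneg h0 h0]
  have a2 : 0 ≤ x ^ 2 * (1 - x) := mul_nonneg (sq_nonneg x) (by linarith)
  have b1 : max (x - 2 / 3) 0 * (1 - x) ≤ 1 / 3 * 1 :=
    mul_le_mul hm (by linarith) (by linarith) (by norm_num)
  have b2 : 0 ≤ max (x - 2 / 3) 0 * (1 - x) := mul_nonneg hm0 (by linarith)
  rw [Hfun_eq]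
  refine abs_le.2 ⟨by linarith, by linarith⟩

lemma abs_poissonRatio_sub_low_order_le {n : ℕ} (hn : 4 ≤ n) {x : ℝ} (hx0 : 0 ≤ x)
    (hx1 : x ≤ 1) :
    |poissonRatio n x - (1 - x ^ 2 / 2 * (1 / n))| ≤ 6 * (1 / (n : ℝ)) ^ 2 ∧
      |poissonRatio n x - 1| ≤ 4 * (1 / (n : ℝ)) := by
  have hn4 : (4 : ℝ) ≤ n := by exact_mod_cast hn
  have hn0 : (0 : ℝ) < n := by linarith
  have hr := abs_poissonRatio_sub_le (by omega : 2 ≤ n) hx0 hx1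
  obtain ⟨h, hh⟩ : ∃ h : ℝ, h = 1 / n := ⟨_, rfl⟩
  have hh0 : 0 < h := by rw [hh]; positivity
  have hh4 : h ≤ 1 / 4 := by rw [hh]; gcongr
  have e : (1 - x ^ 2 / (2 * n) + x ^ 3 / (3 * n ^ 2) + x ^ 4 / (8 * n ^ 2)) =
      1 - x ^ 2 / 2 * h + (x ^ 3 * h ^ 2 / 3 + x ^ 4 * h ^ 2 / 8) := by
    rw [hh]; ring
  have e' : (10 : ℝ) / n ^ 3 = 10 * h ^ 3 := by rw [hh]; ring
  rw [e, e'] at hr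
  rw [← hh]
  have hh2 : 0 < h ^ 2 := by positivity
  have c0 : h ^ 3 ≤ h ^ 2 / 4 := by
    have := mul_le_mul_of_nonneg_left hh4 hh2.le
    linarith
  have c1 : 0 ≤ x ^ 3 * h ^ 2 := by positivity
  have c2 : x ^ 3 * h ^ 2 ≤ h ^ 2 := mul_le_of_le_one_left hh2.le (pow_le_one₀ hx0 hx1)
  have c3 : 0 ≤ x ^ 4 * h ^ 2 := by positivity
  have c4 : x ^ 4 * h ^ 2 ≤ h ^ 2 := mul_le_of_le_one_left hh2.le (pow_le_one₀ hx0 hx1)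
  have c5 : 0 ≤ x ^ 2 * h := by positivity
  have c6 : x ^ 2 * h ≤ h := mul_le_of_le_one_left hh0.le (pow_le_one₀ hx0 hx1)
  have c7 : h ^ 2 ≤ h / 4 := by
    have := mul_le_mul_of_nonneg_left hh4 hh0.le
    linarith
  obtain ⟨r1, r2⟩ := abs_le.1 hr
  exact ⟨abs_le.2 ⟨by linarith, by linarith⟩, abs_le.2 ⟨by linarith, by linarith⟩⟩

lemma abs_cdf_expansion_le {n : ℕ} (hn : 4 ≤ n) {x κ v : ℝ} (hx0 : 0 ≤ x) (hx1 : x ≤ 1)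
    (hκ : |κ| ≤ 1) (hv : v = x + 1 / 3 + κ / (n + x)) (hv1 : |v - 1| ≤ 1) :
    |poissonCdf n (n + x) + (v - 1) * poissonProb n (n + x)
      + max (v - 1) 0 * (poissonProb (n + 1) (n + x) - poissonProb n (n + x)) - 1 / 2
      - poissonProb n n * ((κ - Hfun x) / n)| ≤ poissonProb n n * (100 / (n : ℝ) ^ 2) := by
  have hn4 : (4 : ℝ) ≤ n := by exact_mod_cast hn
  have hn0 : (0 : ℝ) < n := by linarith
  have hp := poissonProb_pos hn0 n
  have hc := abs_poissonCdf_add_sub_le (by omega : 2 ≤ n) hx0 hx1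
  have hb := abs_ramanujanSeq_sub_half_le (by omega : 2 ≤ n)
  have hs : poissonProb (n + 1) (n + x) - poissonProb n (n + x) =
      -(poissonProb n (n + x) * ((1 - x) / (n + 1))) := by
    rw [poissonProb, poissonProb, Nat.factorial_succ]
    push_cast
    field_simp
    ring
  rw [hs, poissonProb_add (by omega)]
  set q := poissonProb n n with hq
  set R := poissonRatio n x with hR
  obtain ⟨h, hh⟩ : ∃ h : ℝ, h = 1 / n := ⟨_, rfl⟩
  have hh0 : 0 < h := by rw [hh]; positivity
  have hh4 : h ≤ 1 / 4 := by rw [hh]; gcongr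
  have hh2 : 0 < h ^ 2 := by positivity
  have hh3 : h ^ 3 ≤ h ^ 2 := pow_le_pow_of_le_one hh0.le (by linarith) (by norm_num)
  obtain ⟨j, hj⟩ : ∃ j : ℝ, j = 1 / (n + 1) := ⟨_, rfl⟩
  obtain ⟨i, hi⟩ : ∃ i : ℝ, i = 1 / (n + x) := ⟨_, rfl⟩
  have hj0 : 0 < j := by rw [hj]; positivity
  have hi0 : 0 < i := by rw [hi]; positivity
  have hjh : j ≤ h := by rw [hj, hh]; gcongr; linarith
  have hih : i ≤ h := by rw [hi, hh]; gcongr; linarith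
  have hij : h - i = x * h * i := by rw [hi, hh]; field_simp; ring
  have hjj : h - j = h * j := by rw [hj, hh]; field_simp; ring
  have hx2 : x ^ 2 ≤ 1 := pow_le_one₀ hx0 hx1
  have hx4 : x ^ 4 ≤ 1 := pow_le_one₀ hx0 hx1
  have hx5 : x ^ 5 ≤ 1 := pow_le_one₀ hx0 hx1
  obtain ⟨hr2, hr1⟩ := abs_poissonRatio_sub_low_order_le hn hx0 hx1
  rw [← hh, ← hR] at hr2 hr1
  have hvi : v - 1 = x - 2 / 3 + κ * i := by rw [hv, hi]; ring
  have hki : |κ * i| ≤ h := by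
    rw [abs_mul, abs_of_pos hi0]
    exact (mul_le_of_le_one_left hi0.le hκ).trans hih
  have hM : |max (v - 1) 0| ≤ 1 := by
    rw [abs_of_nonneg (le_max_right _ _)]
    exact max_le (abs_le.1 hv1).2 zero_le_one
  have hMM : |max (v - 1) 0 - max (x - 2 / 3) 0| ≤ h := by
    refine (abs_max_sub_max_le_abs _ _ _).trans ?_
    rw [hvi, add_sub_cancel_left]
    exact hki
  set M := max (v - 1) 0
  set M₀ := max (x - 2 / 3) 0 with hM₀
  have t1 : |(v - 1) * (R - (1 - x ^ 2 / 2 * h))| ≤ 1 * (6 * h ^ 2) := by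
    rw [abs_mul]; gcongr
  have t2 : |κ * i * (x * h)| ≤ h * (1 * h) := by
    rw [abs_mul, abs_mul x, abs_of_pos hh0, abs_of_nonneg hx0]; gcongr
  have t3 : |κ * i * (x ^ 2 / 2 * h)| ≤ h * (1 / 2 * h) := by
    rw [abs_mul, abs_of_nonneg (by positivity : 0 ≤ x ^ 2 / 2 * h)]; gcongr
  have t4 : |(1 - x) * (M * (R - 1) * j)| ≤ 1 * (1 * (4 * h) * h) := by
    rw [abs_mul, abs_mul, abs_mul, abs_of_pos hj0, abs_of_nonneg (by linarith : 0 ≤ 1 - x)]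
    gcongr
    linarith
  have t5 : |(1 - x) * (M * (h * j))| ≤ 1 * (1 * (h * h)) := by
    rw [abs_mul, abs_mul, abs_of_pos (mul_pos hh0 hj0), abs_of_nonneg (by linarith : 0 ≤ 1 - x)]
    gcongr
    linarith
  have t6 : |(1 - x) * ((M - M₀) * h)| ≤ 1 * (h * h) := by
    rw [abs_mul, abs_mul, abs_of_pos hh0, abs_of_nonneg (by linarith : 0 ≤ 1 - x)]
    gcongr
    linarith
  obtain ⟨a, ha⟩ : ∃ a : ℝ, a = (v - 1) * (R - (1 - x ^ 2 / 2 * h)) - κ * i * (x * h)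
      - κ * i * (x ^ 2 / 2 * h) - (1 - x) * (M * (R - 1) * j) + (1 - x) * (M * (h * j))
      - (1 - x) * ((M - M₀) * h) - (x ^ 4 * h ^ 2 / 12 + x ^ 5 * h ^ 2 / 40) := ⟨_, rfl⟩
  have hab : |a| ≤ 20 * h ^ 2 := by
    have c1 : 0 ≤ x ^ 5 * h ^ 2 := by positivity
    have c2 : x ^ 5 * h ^ 2 ≤ h ^ 2 := mul_le_of_le_one_left hh2.le hx5
    have c3 : 0 ≤ x ^ 4 * h ^ 2 := by positivity
    have c4 : x ^ 4 * h ^ 2 ≤ h ^ 2 := mul_le_of_le_one_left hh2.le hx4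
    rw [abs_le] at t1 t2 t3 t4 t5 t6
    rw [ha]
    exact abs_le.2 ⟨by linarith, by linarith⟩
  have e1 : (x - x ^ 3 / (6 * n) + x ^ 4 / (12 * n ^ 2) + x ^ 5 / (40 * n ^ 2)) =
      x - x ^ 3 / 6 * h + x ^ 4 * h ^ 2 / 12 + x ^ 5 * h ^ 2 / 40 := by
    rw [hh]; field_simp
  have e2 : q * (10 / (n : ℝ) ^ 3) = q * (10 * h ^ 3) := by rw [hh]; field_simp
  have e3 : 40 * q / (n : ℝ) ^ 2 = q * (40 * h ^ 2) := by rw [hh]; field_simp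
  have e4 : q * (100 / (n : ℝ) ^ 2) = q * (100 * h ^ 2) := by rw [hh]; field_simp
  have e5 : ramanujanSeq n = poissonCdf n n - (2 / 3 - 4 / 135 * h) * q := by
    rw [ramanujanSeq, hh]; ring
  rw [e1, e2] at hc
  rw [e3, e5] at hb
  rw [e4]
  have e6 : poissonCdf n (n + x) + (v - 1) * (q * R) + M * -(q * R * ((1 - x) / (n + 1))) - 1 / 2
      - q * ((κ - Hfun x) / n) =
      (poissonCdf n (n + x) - poissonCdf n n +
        q * (x - x ^ 3 / 6 * h + x ^ 4 * h ^ 2 / 12 + x ^ 5 * h ^ 2 / 40)) +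
      (poissonCdf n n - (2 / 3 - 4 / 135 * h) * q - 1 / 2) + q * a := by
    have d1 : (1 - x) / (n + 1) = (1 - x) * j := by rw [hj]; ring
    have d2 : (κ - Hfun x) / n = (κ - Hfun x) * h := by rw [hh]; ring
    rw [d1, d2, Hfun_eq, ← hM₀, ha]
    linear_combination q * hvi - q * (x ^ 2 / 2 * h) * hvi - q * κ * hij
      + q * (1 - x) * M * hjj
  have hqa : |q * a| ≤ q * (20 * h ^ 2) := by
    rw [abs_mul, abs_of_pos hp]; gcongr
  have hq3 : q * (10 * h ^ 3) ≤ q * (10 * h ^ 2) := by gcongr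
  have hq0 : 0 ≤ q * h ^ 2 := by positivity
  rw [e6]
  rw [abs_le] at hc hb hqa
  exact abs_le.2 ⟨by linarith, by linarith⟩

lemma half_le_zMeasure_Iic_iff {l : ℝ} (hl : 0 < l) (n : ℕ) {v : ℝ} (h0 : 0 ≤ v) (h2 : v ≤ 2) :
    (1 : ℝ≥0∞) / 2 ≤ zMeasure l (Set.Iic (n + v)) ↔
      0 ≤ poissonCdf n l + (v - 1) * poissonProb n l
        + max (v - 1) 0 * (poissonProb (n + 1) l - poissonProb n l) - 1 / 2 := by
  have e : (1 : ℝ≥0∞) / 2 = ENNReal.ofReal (1 / 2) := by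
    rw [ENNReal.ofReal_div_of_pos (by norm_num)]; simp
  rw [zMeasure_Iic_add hl n h0 h2, e, ENNReal.ofReal_le_ofReal_iff', sub_nonneg]
  exact ⟨fun h => h.resolve_right (by norm_num), Or.inl⟩

/-- On the scale `1 / l`, the median of `Z_l` is at distance at most `δ` from its expansion. -/
lemma abs_medianZ_sub_le {n : ℕ} {x δ : ℝ} (hn : 4 ≤ n) (hx0 : 0 ≤ x) (hx1 : x < 1) (hδ : 0 < δ)
    (hδ1 : δ ≤ 1 / 2) (hnδ : 100 / δ < n) :
    |(n + x) * (medianZ (n + x) - (n + x) - 1 / 3) - Hfun x| ≤ δ := by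
  have hn4 : (4 : ℝ) ≤ n := by exact_mod_cast hn
  have hn0 : (0 : ℝ) < n := by linarith
  have hl : 0 < n + x := by linarith
  have hp := poissonProb_pos hn0 n
  have hH := abs_le.1 (abs_Hfun_le hx0 hx1.le)
  have hsmall : 100 / (n : ℝ) ^ 2 < δ / n := by
    rw [div_lt_iff₀ hδ] at hnδ
    rw [div_lt_div_iff₀ (by positivity) hn0]
    nlinarith
  have hv : ∀ κ : ℝ, |κ| ≤ 1 →
      0 ≤ x + 1 / 3 + κ / (n + x) ∧ x + 1 / 3 + κ / (n + x) ≤ 2 := by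
    intro κ hκ
    have : |κ / (n + x)| ≤ 1 / 4 := by
      rw [abs_div, abs_of_pos hl]
      gcongr
      linarith
    rw [abs_le] at this
    constructor <;> linarith
  have hpt : ∀ κ : ℝ, n + x + 1 / 3 + κ / (n + x) = n + (x + 1 / 3 + κ / (n + x)) := by
    intro κ; ring
  have hexp : ∀ κ : ℝ, |κ| ≤ 1 → _ := fun κ hκ => abs_le.1 (abs_cdf_expansion_le hn hx0 hx1.le hκ rfl
    (abs_le.2 ⟨by linarith [(hv κ hκ).1], by linarith [(hv κ hκ).2]⟩))
  have hqs := mul_lt_mul_of_pos_left hsmall hp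
  have hup : n + x + 1 / 3 + (Hfun x + δ) / (n + x) ∈
      {t : ℝ | (1 : ℝ≥0∞) / 2 ≤ zMeasure (n + x) (Set.Iic t)} := by
    have hκ : |Hfun x + δ| ≤ 1 := abs_le.2 ⟨by linarith, by linarith⟩
    rw [Set.mem_ofPred_eq, hpt, half_le_zMeasure_Iic_iff hl n (hv _ hκ).1 (hv _ hκ).2]
    have := (hexp _ hκ).1
    rw [add_sub_cancel_left] at this
    linarith
  have hlow : ∀ t ∈ {t : ℝ | (1 : ℝ≥0∞) / 2 ≤ zMeasure (n + x) (Set.Iic t)},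
      n + x + 1 / 3 + (Hfun x - δ) / (n + x) ≤ t := by
    intro t ht
    by_contra! hlt
    have hκ : |Hfun x - δ| ≤ 1 := abs_le.2 ⟨by linarith, by linarith⟩
    have h1 := le_trans ht (measure_mono (Set.Iic_subset_Iic.2 hlt.le))
    rw [hpt, half_le_zMeasure_Iic_iff hl n (hv _ hκ).1 (hv _ hκ).2] at h1
    have := (hexp _ hκ).2
    have e : (Hfun x - δ - Hfun x) / n = -(δ / n) := by ring
    rw [e, mul_neg] at this
    linarith
  have m1 : medianZ (n + x) ≤ _ := csInf_le ⟨_, hlow⟩ hup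
  have m2 : _ ≤ medianZ (n + x) := le_csInf ⟨_, hup⟩ hlow
  have s1 : (n + x) * (medianZ (n + x) - (n + x) - 1 / 3) ≤ Hfun x + δ := by
    rw [← le_div_iff₀' hl]; linarith
  have s2 : Hfun x - δ ≤ (n + x) * (medianZ (n + x) - (n + x) - 1 / 3) := by
    rw [← div_le_iff₀' hl]; linarith
  exact abs_le.2 ⟨by linarith, by linarith⟩

theorem median_jittered_poisson :
    Tendsto (fun l : ℝ => l * (medianZ l - l - 1 / 3) - Hfun (l - ⌊l⌋)) atTop (nhds 0) := by
  rw [Metric.tendsto_nhds]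
  intro ε hε
  set δ := min (ε / 2) (1 / 2) with hδ_def
  have hδ : 0 < δ := lt_min (by linarith) (by norm_num)
  have hN := tendsto_natCast_atTop_atTop (R := ℝ) |>.comp (tendsto_nat_floor_atTop (α := ℝ))
  filter_upwards [hN.eventually_ge_atTop 4, hN.eventually_gt_atTop (100 / δ), eventually_ge_atTop 0]
    with l h4 hl hl0
  have hfl : ((⌊l⌋₊ : ℕ) : ℝ) = ⌊l⌋ := natCast_floor_eq_intCast_floor hl0
  have h4' : ((4 : ℕ) : ℝ) ≤ (⌊l⌋₊ : ℕ) := h4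
  have key := abs_medianZ_sub_le (x := l - ⌊l⌋) (Nat.cast_le.1 h4') (sub_nonneg.2 (Int.floor_le l))
    (by linarith [Int.lt_floor_add_one l]) hδ (min_le_right _ _) hl
  rw [hfl, add_sub_cancel] at key
  rw [Real.dist_eq, sub_zero]
  exact key.trans_lt ((min_le_left _ _).trans_lt (by linarith))
end

section
/- (Proposition 1) Let x ∈ [0,1). For any ε > 0 there exists n₀ ∈ ℕ such that for all n ≥ n₀, (H(x) − ε)/(n+x) ≤ Me_{Z_{n+x}} − (n+x) − 1/3 ≤ (H(x) + ε)/(n+x). -/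
open MeasureTheory ProbabilityTheory Filter Real Set
open scoped ENNReal NNReal

open scoped Topology

/-- The probability that a Poisson variable with parameter `u` is at most `n`. -/
noncomputable def poissonCDF (n : ℕ) (u : ℝ) : ℝ :=
  Real.exp (-u) * ∑ k ∈ Finset.range (n + 1), u ^ k / k.factorial

lemma zMeasure_Iic_s4 {l : ℝ} (hl : 0 ≤ l) (m : ℕ) {s : ℝ} (hs0 : 0 ≤ s) (hs1 : s ≤ 1) :
    zMeasure l (Set.Iic (m + s)) = ENNReal.ofReal
      (∑ k ∈ Finset.range m, Real.exp (-l) * l ^ k / k.factorial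
        + s * (Real.exp (-l) * l ^ m / m.factorial)) := by
  have hpos : ∀ k : ℕ, 0 ≤ Real.exp (-l) * l ^ k / k.factorial := fun k => by positivity
  have hsec : ∀ k : ℕ, (volume.restrict (Set.Ioo (0 : ℝ) 1))
      (Prod.mk (k : ℝ) ⁻¹' ((fun p : ℝ × ℝ => p.1 + p.2) ⁻¹' Set.Iic (m + s))) =
        if k < m then 1 else if k = m then ENNReal.ofReal s else 0 := by
    intro k
    have hset : Prod.mk (k : ℝ) ⁻¹' ((fun p : ℝ × ℝ => p.1 + p.2) ⁻¹' Set.Iic (m + s)) =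
        Set.Iic (m + s - k) := by
      ext u
      simp only [Set.mem_preimage, Set.mem_Iic]
      constructor <;> intro h <;> linarith
    rw [hset, Measure.restrict_apply measurableSet_Iic]
    split_ifs with h1 h2
    · have : (k : ℝ) + 1 ≤ m := by exact_mod_cast h1
      rw [Set.inter_eq_right.2 (fun u hu => by simp only [Set.mem_Iic]; linarith [hu.2])]
      simp
    · subst h2
      apply le_antisymm
      · calc volume (Set.Iic ((k : ℝ) + s - k) ∩ Set.Ioo 0 1)
            ≤ volume (Set.Icc (0 : ℝ) s) := by
              apply measure_mono
              intro u hu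
              have := hu.1
              simp only [Set.mem_Iic] at this
              exact ⟨hu.2.1.le, by linarith⟩
          _ = ENNReal.ofReal s := by simp
      · calc ENNReal.ofReal s = volume (Set.Ioo (0 : ℝ) s) := by simp
          _ ≤ volume (Set.Iic ((k : ℝ) + s - k) ∩ Set.Ioo 0 1) := by
              apply measure_mono
              intro u hu
              exact ⟨by simp only [Set.mem_Iic]; linarith [hu.2], hu.1, hu.2.trans_le hs1⟩
    · have h3 : m + 1 ≤ k := by omega
      have : (m : ℝ) + 1 ≤ k := by exact_mod_cast h3
      rw [show Set.Iic ((m : ℝ) + s - k) ∩ Set.Ioo 0 1 = ∅ from ?_]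
      · simp
      · ext u
        simp only [Set.mem_inter_iff, Set.mem_Iic, Set.mem_Ioo, Set.mem_empty_iff_false,
          iff_false]
        rintro ⟨h, h', -⟩
        linarith
  have hmeas : MeasurableSet ((fun p : ℝ × ℝ => p.1 + p.2) ⁻¹' Set.Iic (m + s)) :=
    (measurable_fst.add measurable_snd) measurableSet_Iic
  rw [zMeasure, Measure.map_apply (by fun_prop) measurableSet_Iic, Measure.prod_apply hmeas,
    lintegral_map (measurable_measure_prodMk_left hmeas) .of_discrete, poissonMeasure,
    lintegral_sum_measure]
  simp only [lintegral_smul_measure, lintegral_dirac, hsec, Real.coe_toNNReal l hl, smul_eq_mul]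
  rw [tsum_eq_sum (s := Finset.range (m + 1)), Finset.sum_range_succ, ENNReal.ofReal_add
    (Finset.sum_nonneg fun k _ => hpos k) (mul_nonneg hs0 (hpos m)),
    ENNReal.ofReal_sum_of_nonneg fun k _ => hpos k, ENNReal.ofReal_mul hs0]
  · congr 1
    · refine Finset.sum_congr rfl fun k hk => ?_
      rw [if_pos (Finset.mem_range.1 hk), mul_one]
    · simp [mul_comm]
  · intro k hk
    have : m < k := by simpa using hk
    simp [this.not_gt, this.ne']

lemma medianZ_mem_Icc {l t₁ t₂ : ℝ} (h₁ : zMeasure l (Set.Iic t₁) < 1 / 2)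
    (h₂ : 1 / 2 ≤ zMeasure l (Set.Iic t₂)) : medianZ l ∈ Set.Icc t₁ t₂ := by
  have hlow : ∀ t ∈ {t : ℝ | (1 : ℝ≥0∞) / 2 ≤ zMeasure l (Set.Iic t)}, t₁ ≤ t := by
    intro t ht
    by_contra! hlt
    exact absurd (ht.trans (measure_mono (Set.Iic_subset_Iic.2 hlt.le))) h₁.not_ge
  exact ⟨le_csInf ⟨t₂, h₂⟩ hlow, csInf_le ⟨t₁, hlow⟩ h₂⟩

lemma poissonCDF_zero (n : ℕ) : poissonCDF n 0 = 1 := by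
  simp [poissonCDF, Finset.sum_range_succ']

lemma poissonCDF_succ (n : ℕ) (u : ℝ) :
    poissonCDF (n + 1) u = poissonCDF n u + g (n + 1) u / (n + 1).factorial := by
  rw [poissonCDF, Finset.sum_range_succ, poissonCDF, g]
  ring

lemma hasDerivAt_poissonCDF (n : ℕ) (u : ℝ) :
    HasDerivAt (poissonCDF n) (-(g n u / n.factorial)) u := by
  induction n with
  | zero =>
    have h : poissonCDF 0 = fun u => Real.exp (-u) := by
      ext v
      simp [poissonCDF]
    rw [h]
    simpa [g] using (hasDerivAt_neg u).exp
  | succ n ih =>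
    have h : poissonCDF (n + 1) = fun u =>
        poissonCDF n u + Real.exp (-u) * u ^ (n + 1) / (n + 1).factorial :=
      funext fun v => poissonCDF_succ n v
    rw [h]
    convert! ih.add (((hasDerivAt_neg u).exp.mul (hasDerivAt_pow (n + 1) u)).div_const
      ((n + 1).factorial : ℝ)) using 1
    have : (n.factorial : ℝ) ≠ 0 := by positivity
    simp only [g, Nat.factorial_succ, Nat.add_sub_cancel]
    push_cast
    field_simp
    ring

lemma continuous_g (n : ℕ) : Continuous (g n) := by
  unfold g
  fun_prop

lemma poissonCDF_sub (n : ℕ) (u v : ℝ) :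
    poissonCDF n u - poissonCDF n v = (∫ z in u..v, g n z) / n.factorial := by
  have h := intervalIntegral.integral_eq_sub_of_hasDerivAt
    (fun z _ => hasDerivAt_poissonCDF n z)
    (((continuous_g n).div_const _).neg.intervalIntegrable u v)
  rw [intervalIntegral.integral_neg, intervalIntegral.integral_div] at h
  linarith

lemma one_sub_le_exp {y : ℝ} (hy0 : 0 ≤ y) (hy1 : y ≤ 1) :
    1 - y ≤ Real.exp (-y - y ^ 2 / 2) := by
  rcases hy1.eq_or_lt with rfl | hy
  · simpa using (Real.exp_pos _).le
  have h := sum_le_hasSum (Finset.range 2) (fun i _ => by positivity)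
    (Real.hasSum_pow_div_log_of_abs_lt_one (abs_lt.2 ⟨by linarith, hy⟩))
  norm_num [Finset.sum_range_succ] at h
  rw [← Real.log_le_iff_le_exp (by linarith)]
  linarith

lemma g_le_self (n : ℕ) {u : ℝ} (hu : 0 ≤ u) : g n u ≤ g n n := by
  rcases n.eq_zero_or_pos with rfl | hn
  · simpa [g] using hu
  have hn' : (0 : ℝ) < n := by exact_mod_cast hn
  have h : u / n ≤ Real.exp (u / n - 1) := by
    linarith [Real.add_one_le_exp (u / n - 1)]
  have h2 : u ^ n ≤ n ^ n * Real.exp (u - n) := by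
    calc u ^ n = n ^ n * (u / n) ^ n := by rw [← mul_pow]; congr 1; field_simp
      _ ≤ n ^ n * Real.exp (u / n - 1) ^ n := by gcongr
      _ = n ^ n * Real.exp (u - n) := by
        rw [← Real.exp_nat_mul]; congr 2; field_simp
  calc g n u ≤ Real.exp (-u) * (n ^ n * Real.exp (u - n)) := by unfold g; gcongr
    _ = Real.exp (-u) * Real.exp (u - n) * n ^ n := by ring
    _ = g n n := by rw [← Real.exp_add, g]; congr 2; ring

/-- The density of the centred and rescaled Gamma distribution to the left of its mode. -/
noncomputable def scaledDensity (n : ℕ) (s : ℝ) : ℝ :=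
  (1 - s / √n) ^ n * Real.exp (√n * s)

lemma scaledDensity_le {n : ℕ} (hn : 0 < n) {s : ℝ} (hs0 : 0 ≤ s) (hs : s ≤ √n) :
    scaledDensity n s ≤ Real.exp (-(1 / 2) * s ^ 2) := by
  have hq : 0 < √(n : ℝ) := Real.sqrt_pos.2 (by exact_mod_cast hn)
  have hqq : √(n : ℝ) ^ 2 = n := Real.sq_sqrt (Nat.cast_nonneg n)
  have h1 : s / √n ≤ 1 := (div_le_one hq).2 hs
  have h0 : 0 ≤ s / √n := by positivity
  calc scaledDensity n s
      ≤ Real.exp (-(s / √n) - (s / √n) ^ 2 / 2) ^ n * Real.exp (√n * s) := by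
        unfold scaledDensity
        have h2 : 0 ≤ 1 - s / √n := by linarith
        gcongr
        exact one_sub_le_exp h0 h1
    _ = Real.exp (-(1 / 2) * s ^ 2) := by
        rw [← Real.exp_nat_mul, ← Real.exp_add, ← hqq]
        congr 1
        simp only [Real.sqrt_sq hq.le]
        field_simp
        ring

lemma tendsto_scaledDensity {s : ℝ} (hs : 0 < s) :
    Tendsto (fun n : ℕ => scaledDensity n s) atTop (𝓝 (Real.exp (-(1 / 2) * s ^ 2))) := by
  have hsq : Tendsto (fun n : ℕ => √(n : ℝ)) atTop atTop :=
    Real.tendsto_sqrt_atTop.comp tendsto_natCast_atTop_atTop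
  have hy : Tendsto (fun n : ℕ => s / √(n : ℝ)) atTop (𝓝 0) := hsq.const_div_atTop s
  have hbound : Tendsto (fun n : ℕ => s ^ 2 * (s / √(n : ℝ)) / (1 - s / √(n : ℝ))) atTop
      (𝓝 0) := by
    have := (hy.const_mul (s ^ 2)).div (tendsto_const_nhds.sub hy) (by norm_num : (1 : ℝ) - 0 ≠ 0)
    rw [mul_zero, zero_div] at this
    exact this
  have hlog : Tendsto (fun n : ℕ => n * Real.log (1 - s / √n) + √n * s) atTop
      (𝓝 (-(1 / 2) * s ^ 2)) := by
    rw [tendsto_iff_norm_sub_tendsto_zero]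
    refine squeeze_zero' (Eventually.of_forall fun _ => norm_nonneg _) ?_ hbound
    filter_upwards [hsq.eventually_gt_atTop s, eventually_gt_atTop 0] with n hn hn0
    have hq : 0 < √(n : ℝ) := hs.trans hn
    have hqq : √(n : ℝ) ^ 2 = n := Real.sq_sqrt (Nat.cast_nonneg n)
    have hy0 : 0 < s / √(n : ℝ) := by positivity
    have hy1 : s / √(n : ℝ) < 1 := (div_lt_one hq).2 hn
    have h := Real.abs_log_sub_add_sum_range_le (by rwa [abs_of_pos hy0]) 2
    rw [abs_of_pos hy0] at h
    norm_num [Finset.sum_range_succ] at h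
    rw [Real.norm_eq_abs]
    calc |n * Real.log (1 - s / √n) + √n * s - -(1 / 2) * s ^ 2|
        = |√(n : ℝ) ^ 2 * (s / √n + (s / √n) ^ 2 / 2 + Real.log (1 - s / √n))| := by
          congr 1
          rw [← hqq, Real.sqrt_sq hq.le]
          field_simp
          ring
      _ ≤ √(n : ℝ) ^ 2 * ((s / √n) ^ 3 / (1 - s / √n)) := by
          rw [abs_mul, abs_of_pos (by positivity : 0 < √(n : ℝ) ^ 2)]
          gcongr
      _ = s ^ 2 * (s / √n) / (1 - s / √n) := by
          have : 1 - s / √(n : ℝ) ≠ 0 := by linarith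
          field_simp
  refine ((Real.continuous_exp.tendsto _).comp hlog).congr' ?_
  filter_upwards [hsq.eventually_gt_atTop s] with n hn
  have hq : 0 < √(n : ℝ) := hs.trans hn
  have hy1 : s / √(n : ℝ) < 1 := (div_lt_one hq).2 hn
  rw [Function.comp_apply, Real.exp_add, Real.exp_nat_mul, Real.exp_log (by linarith),
    scaledDensity]

lemma tendsto_integral_scaledDensity :
    Tendsto (fun n : ℕ => ∫ s in (0 : ℝ)..√n, scaledDensity n s) atTop (𝓝 (√(2 * π) / 2)) := by
  have key : Tendsto (fun n : ℕ => ∫ s in Set.Ioi (0 : ℝ),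
      (Set.Iic √(n : ℝ)).indicator (scaledDensity n) s) atTop
      (𝓝 (∫ s in Set.Ioi (0 : ℝ), Real.exp (-(1 / 2) * s ^ 2))) := by
    refine tendsto_integral_filter_of_dominated_convergence
      (fun s => Real.exp (-(1 / 2) * s ^ 2)) ?_ ?_
      (integrable_exp_neg_mul_sq (by norm_num)).integrableOn ?_
    · refine Eventually.of_forall fun n => ?_
      have : Continuous (scaledDensity n) := by unfold scaledDensity; fun_prop
      exact (this.measurable.indicator measurableSet_Iic).aestronglyMeasurable
    · filter_upwards [eventually_gt_atTop 0] with n hn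
      filter_upwards [ae_restrict_mem measurableSet_Ioi] with s hs
      have hs0 : 0 < s := hs
      by_cases h : s ∈ Set.Iic √(n : ℝ)
      · rw [Set.indicator_of_mem h, Real.norm_of_nonneg]
        · exact scaledDensity_le hn hs0.le h
        · have : s / √n ≤ 1 := (div_le_one (hs0.trans_le h)).2 h
          unfold scaledDensity
          have : 0 ≤ 1 - s / √n := by linarith
          positivity
      · rw [Set.indicator_of_notMem h, norm_zero]
        positivity
    · filter_upwards [ae_restrict_mem measurableSet_Ioi] with s hs
      refine (tendsto_scaledDensity hs).congr' ?_
      have hsq : Tendsto (fun n : ℕ => √(n : ℝ)) atTop atTop :=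
        Real.tendsto_sqrt_atTop.comp tendsto_natCast_atTop_atTop
      filter_upwards [hsq.eventually_ge_atTop s] with n hn
      rw [Set.indicator_of_mem (Set.mem_Iic.2 hn)]
  rw [integral_gaussian_Ioi, show π / (1 / 2) = 2 * π by ring] at key
  refine key.congr fun n => ?_
  rw [setIntegral_indicator measurableSet_Iic, Set.Ioi_inter_Iic,
    intervalIntegral.integral_of_le (Real.sqrt_nonneg _)]

lemma tendsto_sqrt_mul_g_div_factorial :
    Tendsto (fun n : ℕ => √n * (g n n / n.factorial)) atTop (𝓝 (1 / √(2 * π))) := by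
  have h := (Stirling.tendsto_stirlingSeq_sqrt_pi.inv₀ (by positivity)).const_mul (√2)⁻¹
  rw [show (√2)⁻¹ * (√π)⁻¹ = 1 / √(2 * π) by
    rw [Real.sqrt_mul (by norm_num)]; field_simp] at h
  refine h.congr fun n => ?_
  rw [Stirling.stirlingSeq, g, Real.sqrt_mul (by norm_num), div_pow, ← Real.exp_nat_mul,
    Real.exp_neg, mul_one]
  have : √(2 : ℝ) ≠ 0 := by positivity
  have : (n.factorial : ℝ) ≠ 0 := by positivity
  rw [inv_div]
  field_simp

lemma tendsto_g_div_factorial :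
    Tendsto (fun n : ℕ => g n n / n.factorial) atTop (𝓝 0) := by
  have hsq : Tendsto (fun n : ℕ => √(n : ℝ)) atTop atTop :=
    Real.tendsto_sqrt_atTop.comp tendsto_natCast_atTop_atTop
  refine (tendsto_sqrt_mul_g_div_factorial.div_atTop hsq).congr' ?_
  filter_upwards [hsq.eventually_gt_atTop 0] with n hn
  field_simp

lemma tendsto_poissonCDF_self : Tendsto (fun n : ℕ => poissonCDF n n) atTop (𝓝 (1 / 2)) := by
  have h := (tendsto_sqrt_mul_g_div_factorial.mul tendsto_integral_scaledDensity).const_sub 1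
  rw [show 1 - 1 / √(2 * π) * (√(2 * π) / 2) = 1 / 2 by
    have : √(2 * π) ≠ 0 := by positivity
    field_simp; norm_num] at h
  refine h.congr' ?_
  filter_upwards [eventually_gt_atTop 0] with n hn
  have hq : 0 < √(n : ℝ) := Real.sqrt_pos.2 (by exact_mod_cast hn)
  have hqq : √(n : ℝ) * √(n : ℝ) = n := Real.mul_self_sqrt (Nat.cast_nonneg n)
  have h1 := intervalIntegral.integral_comp_sub_mul (a := 0) (b := √(n : ℝ)) (g n) hq.ne' n
  have h2 : ∀ s, g n (n - √n * s) = g n n * scaledDensity n s := by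
    intro s
    have h3 : (n : ℝ) - √n * s = n * (1 - s / √n) := by
      have : √(n : ℝ) * s = n * (s / √n) := by
        nth_rewrite 2 [← hqq]; field_simp
      rw [this]; ring
    rw [g, g, scaledDensity, show -((n : ℝ) - √n * s) = -n + √n * s by ring, Real.exp_add, h3,
      mul_pow]
    ring
  simp only [h2, hqq, mul_zero, sub_zero, sub_self, smul_eq_mul,
    intervalIntegral.integral_const_mul] at h1
  have h4 := poissonCDF_sub n 0 n
  rw [poissonCDF_zero] at h4
  have h5 : (∫ z in (0 : ℝ)..n, g n z) = √n * (g n n * ∫ s in (0 : ℝ)..√n, scaledDensity n s) := by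
    rw [h1]; field_simp
  rw [h5] at h4
  linear_combination h4

lemma tendsto_poissonCDF_add {x : ℝ} (hx : 0 ≤ x) :
    Tendsto (fun n : ℕ => poissonCDF n (n + x)) atTop (𝓝 (1 / 2)) := by
  have h : Tendsto (fun n : ℕ => poissonCDF n n - poissonCDF n (n + x)) atTop (𝓝 0) := by
    refine squeeze_zero_norm ?_ (by simpa using tendsto_g_div_factorial.mul_const x)
    intro n
    rw [poissonCDF_sub, norm_div, Real.norm_natCast, div_mul_eq_mul_div]
    gcongr
    have := intervalIntegral.norm_integral_le_of_norm_le_const (a := (n : ℝ)) (b := n + x)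
      (f := g n) (C := g n n) (fun u hu => by
        rw [Set.uIoc_of_le (by linarith)] at hu
        have hu0 : 0 ≤ u := (Nat.cast_nonneg n).trans hu.1.le
        rw [Real.norm_of_nonneg (by unfold g; positivity)]
        exact g_le_self n hu0)
    simpa [abs_of_nonneg hx] using this
  simpa using tendsto_poissonCDF_self.sub h

/-- The ratio `(n+1) g_n(N-t) / g_{n+1}(N)` with `N = n + 1 + x`. -/
noncomputable def densityRatio (x : ℝ) (n : ℕ) (t : ℝ) : ℝ :=
  (n + 1) / (n + 1 + x) * (1 - t / (n + 1 + x)) ^ n * Real.exp t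

/-- First-order coefficient of `densityRatio` in powers of `1 / (n + 1 + x)`. -/
noncomputable def ratioCoeffOne (x t : ℝ) : ℝ := (1 + x) * t - t ^ 2 / 2 - x

/-- Second-order coefficient of `densityRatio` in powers of `1 / (n + 1 + x)`. -/
noncomputable def ratioCoeffTwo (x t : ℝ) : ℝ :=
  (1 + x) * t ^ 2 / 2 - t ^ 3 / 3 + ((1 + x) * t - t ^ 2 / 2) ^ 2 / 2
    - x * ((1 + x) * t - t ^ 2 / 2)

lemma abs_mul_log_one_sub_add_sub_le {x t h ν : ℝ} (hx0 : 0 ≤ x) (hx1 : x ≤ 1) (ht0 : 0 ≤ t)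
    (ht1 : t ≤ 1) (hh0 : 0 < h) (hh1 : h ≤ 1 / 10) (hν0 : 0 ≤ ν)
    (hν : ν * h = 1 - h - x * h) :
    |ν * Real.log (1 - t * h) + t - (h * ((1 + x) * t - t ^ 2 / 2)
      + h ^ 2 * ((1 + x) * t ^ 2 / 2 - t ^ 3 / 3))| ≤ 3 * h ^ 3 := by
  have hth0 : 0 ≤ t * h := by positivity
  have hth1 : t * h ≤ h := mul_le_of_le_one_left hh0.le ht1
  have hlog := Real.abs_log_sub_add_sum_range_le (x := t * h)
    (by rw [abs_of_nonneg hth0]; linarith) 3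
  rw [abs_of_nonneg hth0] at hlog
  norm_num [Finset.sum_range_succ] at hlog
  obtain ⟨δ, hδ⟩ : ∃ δ, δ = t * h + (t * h) ^ 2 / 2 + (t * h) ^ 3 / 3 + Real.log (1 - t * h) :=
    ⟨_, rfl⟩
  rw [← hδ] at hlog
  have hδ' : |δ| ≤ 2 * h ^ 4 := by
    refine hlog.trans ?_
    rw [div_le_iff₀ (by linarith)]
    have h4 : (t * h) ^ 4 ≤ h ^ 4 := pow_le_pow_left₀ hth0 hth1 4
    nlinarith [pow_pos hh0 4]
  have hlog' : Real.log (1 - t * h) = δ - (t * h + (t * h) ^ 2 / 2 + (t * h) ^ 3 / 3) := by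
    rw [hδ]; ring
  have hsplit : ν * Real.log (1 - t * h) + t - (h * ((1 + x) * t - t ^ 2 / 2)
      + h ^ 2 * ((1 + x) * t ^ 2 / 2 - t ^ 3 / 3)) =
      (1 + x) * t ^ 3 / 3 * h ^ 3 + ν * δ := by
    rw [hlog']
    linear_combination (-t - t ^ 2 * h / 2 - t ^ 3 * h ^ 2 / 3) * hν
  have hnd : |ν * δ| ≤ 2 * h ^ 3 := by
    rw [abs_mul, abs_of_nonneg hν0]
    have hνh : ν * h ≤ 1 := by rw [hν]; nlinarith
    calc ν * |δ| ≤ ν * (2 * h ^ 4) := mul_le_mul_of_nonneg_left hδ' hν0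
      _ = ν * h * (2 * h ^ 3) := by ring
      _ ≤ 1 * (2 * h ^ 3) := mul_le_mul_of_nonneg_right hνh (by positivity)
      _ = 2 * h ^ 3 := one_mul _
  have hfst : |(1 + x) * t ^ 3 / 3 * h ^ 3| ≤ 1 * h ^ 3 := by
    rw [abs_of_nonneg (by positivity)]
    have ht3 : t ^ 3 ≤ 1 := pow_le_one₀ ht0 ht1
    have ht30 : 0 ≤ t ^ 3 := by positivity
    exact mul_le_mul_of_nonneg_right (by nlinarith) (by positivity)
  rw [hsplit]
  linarith [abs_add_le ((1 + x) * t ^ 3 / 3 * h ^ 3) (ν * δ)]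

lemma abs_exp_sub_quadratic_le {h l₁ l₂ L : ℝ} (hh0 : 0 < h) (hh1 : h ≤ 1 / 10)
    (hl₁ : |l₁| ≤ 2) (hl₂ : |l₂| ≤ 1) (hL : |L - (h * l₁ + h ^ 2 * l₂)| ≤ 3 * h ^ 3) :
    |Real.exp L - (1 + h * l₁ + h ^ 2 * (l₂ + l₁ ^ 2 / 2))| ≤ 73 * h ^ 3 := by
  obtain ⟨A, hA⟩ : ∃ A, A = h * l₁ + h ^ 2 * l₂ := ⟨_, rfl⟩
  rw [← hA] at hL
  have hh2 : h ^ 2 ≤ h / 10 := by nlinarith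
  have hh3 : h ^ 3 ≤ h / 100 := by nlinarith
  have hh4 : h ^ 4 ≤ h ^ 3 / 10 := by nlinarith [pow_pos hh0 3]
  have hp2 : 0 < h ^ 2 := by positivity
  have hp3 : 0 < h ^ 3 := by positivity
  have hp4 : 0 < h ^ 4 := by positivity
  have hAb : |A| ≤ 3 * h := by
    have h1 : |h * l₁| ≤ h * 2 := by
      rw [abs_mul, abs_of_pos hh0]; exact mul_le_mul_of_nonneg_left hl₁ hh0.le
    have h2 : |h ^ 2 * l₂| ≤ h ^ 2 * 1 := by
      rw [abs_mul, abs_of_pos hp2]; exact mul_le_mul_of_nonneg_left hl₂ hp2.le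
    rw [hA]
    linarith [abs_add_le (h * l₁) (h ^ 2 * l₂)]
  have hLb : |L| ≤ 4 * h := by
    have := abs_add_le (L - A) A
    rw [sub_add_cancel] at this
    linarith
  have hexp : |Real.exp L - 1 - L - L ^ 2 / 2| ≤ 64 * h ^ 3 := by
    have hb := Real.exp_bound (x := L) (by linarith) (n := 3) (by norm_num)
    norm_num [Finset.sum_range_succ, Nat.factorial] at hb
    have h64 : |L| ^ 3 ≤ (4 * h) ^ 3 := pow_le_pow_left₀ (abs_nonneg L) hLb 3
    rw [mul_pow] at h64
    have hr : Real.exp L - 1 - L - L ^ 2 / 2 = Real.exp L - (1 + L + L ^ 2 / 2) := by ring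
    rw [hr]
    linarith [pow_nonneg (abs_nonneg L) 3]
  have hquad : |(L - A) * (1 + (L + A) / 2)| ≤ 6 * h ^ 3 := by
    rw [abs_mul]
    have h2 : |1 + (L + A) / 2| ≤ 2 := by
      rw [abs_le] at hAb hLb ⊢
      constructor <;> linarith
    calc |L - A| * |1 + (L + A) / 2| ≤ 3 * h ^ 3 * 2 :=
          mul_le_mul hL h2 (abs_nonneg _) (by positivity)
      _ = 6 * h ^ 3 := by ring
  have hcross : |h ^ 3 * (l₁ * l₂) + h ^ 4 * (l₂ ^ 2 / 2)| ≤ 3 * h ^ 3 := by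
    have h12 : |l₁ * l₂| ≤ 2 * 1 := by
      rw [abs_mul]; exact mul_le_mul hl₁ hl₂ (abs_nonneg _) zero_le_two
    have h22 : l₂ ^ 2 ≤ 1 := by rw [← sq_abs]; exact pow_le_one₀ (abs_nonneg _) hl₂
    have h1 : |h ^ 3 * (l₁ * l₂)| ≤ h ^ 3 * (2 * 1) := by
      rw [abs_mul, abs_of_pos hp3]; exact mul_le_mul_of_nonneg_left h12 hp3.le
    have h2 : |h ^ 4 * (l₂ ^ 2 / 2)| ≤ h ^ 4 * 1 := by
      rw [abs_of_nonneg (by positivity)]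
      exact mul_le_mul_of_nonneg_left (by linarith) hp4.le
    linarith [abs_add_le (h ^ 3 * (l₁ * l₂)) (h ^ 4 * (l₂ ^ 2 / 2))]
  have hsplit : Real.exp L - (1 + h * l₁ + h ^ 2 * (l₂ + l₁ ^ 2 / 2)) =
      (Real.exp L - 1 - L - L ^ 2 / 2) + (L - A) * (1 + (L + A) / 2)
        + (h ^ 3 * (l₁ * l₂) + h ^ 4 * (l₂ ^ 2 / 2)) := by
    rw [hA]; ring
  rw [hsplit]
  linarith [abs_add_three (Real.exp L - 1 - L - L ^ 2 / 2) ((L - A) * (1 + (L + A) / 2))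
    (h ^ 3 * (l₁ * l₂) + h ^ 4 * (l₂ ^ 2 / 2))]

lemma abs_densityRatio_sub_le {x t : ℝ} (hx0 : 0 ≤ x) (hx1 : x ≤ 1) (ht0 : 0 ≤ t) (ht1 : t ≤ 1)
    {n : ℕ} (hn : 10 ≤ n) :
    |densityRatio x n t - 1 - ratioCoeffOne x t / (n + 1 + x)
      - ratioCoeffTwo x t / (n + 1 + x) ^ 2| ≤ 100 / ((n : ℝ) + 1 + x) ^ 3 := by
  have hn' : (10 : ℝ) ≤ n := by exact_mod_cast hn
  obtain ⟨h, hh⟩ : ∃ h : ℝ, h = 1 / (n + 1 + x) := ⟨_, rfl⟩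
  have hN : (0 : ℝ) < n + 1 + x := by positivity
  have hh0 : 0 < h := hh ▸ by positivity
  have hh1 : h ≤ 1 / 10 := by rw [hh]; gcongr; linarith
  have hnh : n * h = 1 - h - x * h := by rw [hh]; field_simp; ring
  have hth1 : t * h ≤ h := mul_le_of_le_one_left hh0.le ht1
  have hprod : densityRatio x n t =
      (1 - x * h) * Real.exp (n * Real.log (1 - t * h) + t) := by
    have h1 : 0 < 1 - t * h := by linarith
    have h2 : ((n : ℝ) + 1) / (n + 1 + x) = 1 - x * (1 / (n + 1 + x)) := by field_simp; ring
    rw [Real.exp_add, Real.exp_nat_mul, Real.exp_log h1, densityRatio, hh, h2, mul_one_div t]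
    ring
  have e1 : ratioCoeffOne x t / (n + 1 + x) = h * ratioCoeffOne x t := by rw [hh]; ring
  have e2 : ratioCoeffTwo x t / (n + 1 + x) ^ 2 = h ^ 2 * ratioCoeffTwo x t := by
    rw [hh]; field_simp
  have e3 : 100 / ((n : ℝ) + 1 + x) ^ 3 = 100 * h ^ 3 := by rw [hh]; field_simp
  rw [hprod, e1, e2, e3]
  have hL := abs_mul_log_one_sub_add_sub_le hx0 hx1 ht0 ht1 hh0 hh1 (Nat.cast_nonneg n) hnh
  obtain ⟨L, hL'⟩ : ∃ L, L = n * Real.log (1 - t * h) + t := ⟨_, rfl⟩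
  obtain ⟨l₁, hl₁⟩ : ∃ l, l = (1 + x) * t - t ^ 2 / 2 := ⟨_, rfl⟩
  obtain ⟨l₂, hl₂⟩ : ∃ l, l = (1 + x) * t ^ 2 / 2 - t ^ 3 / 3 := ⟨_, rfl⟩
  rw [← hL', ← hl₁, ← hl₂] at hL
  have ht2 : t ^ 2 ≤ 1 := pow_le_one₀ ht0 ht1
  have ht3 : t ^ 3 ≤ 1 := pow_le_one₀ ht0 ht1
  have hxt : x * t ≤ 1 := mul_le_one₀ hx1 ht0 ht1
  have hxt0 : 0 ≤ x * t := by positivity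
  have hxt2 : x * t ^ 2 ≤ 1 := mul_le_one₀ hx1 (by positivity) ht2
  have hxt20 : 0 ≤ x * t ^ 2 := by positivity
  have ht30 : 0 ≤ t ^ 3 := by positivity
  have ht20 : 0 ≤ t ^ 2 := by positivity
  have hl₁b : |l₁| ≤ 2 := by rw [hl₁, abs_le]; constructor <;> linarith
  have hl₂b : |l₂| ≤ 1 := by rw [hl₂, abs_le]; constructor <;> linarith
  have hmain := abs_exp_sub_quadratic_le hh0 hh1 hl₁b hl₂b hL
  obtain ⟨m, hm⟩ : ∃ m, m = l₂ + l₁ ^ 2 / 2 := ⟨_, rfl⟩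
  rw [← hm] at hmain
  have hmb : |m| ≤ 3 := by
    have h11 : l₁ ^ 2 ≤ 2 ^ 2 := by
      rw [← sq_abs]; exact pow_le_pow_left₀ (abs_nonneg _) hl₁b 2
    rw [abs_le] at hl₂b ⊢
    rw [hm]
    constructor <;> linarith [sq_nonneg l₁]
  have hxh0 : 0 ≤ x * h := by positivity
  have hxh1 : x * h ≤ 1 := mul_le_one₀ hx1 hh0.le (by linarith)
  have hp3 : 0 < h ^ 3 := by positivity
  have hsplit : (1 - x * h) * Real.exp L - 1 - h * ratioCoeffOne x t
      - h ^ 2 * ratioCoeffTwo x t =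
      (1 - x * h) * (Real.exp L - (1 + h * l₁ + h ^ 2 * m)) + -(x * m) * h ^ 3 := by
    rw [hm, hl₁, hl₂, ratioCoeffOne, ratioCoeffTwo]; ring
  rw [← hL', hsplit]
  have h1 : |(1 - x * h) * (Real.exp L - (1 + h * l₁ + h ^ 2 * m))| ≤ 1 * (73 * h ^ 3) := by
    rw [abs_mul, abs_of_nonneg (by linarith)]
    exact mul_le_mul (by linarith) hmain (abs_nonneg _) zero_le_one
  have h2 : |-(x * m) * h ^ 3| ≤ 1 * 3 * h ^ 3 := by
    rw [abs_mul, abs_neg, abs_mul, abs_of_nonneg hx0, abs_of_pos hp3]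
    exact mul_le_mul_of_nonneg_right (mul_le_mul hx1 hmb (abs_nonneg _) zero_le_one) hp3.le
  linarith [abs_add_le ((1 - x * h) * (Real.exp L - (1 + h * l₁ + h ^ 2 * m)))
    (-(x * m) * h ^ 3)]

lemma continuous_densityRatio (x : ℝ) (n : ℕ) : Continuous (densityRatio x n) := by
  unfold densityRatio
  fun_prop

lemma tendsto_natCast_add (y : ℝ) : Tendsto (fun n : ℕ => (n : ℝ) + y) atTop atTop :=
  tendsto_atTop_add_const_right _ _ tendsto_natCast_atTop_atTop

lemma tendsto_densityRatio_one {x : ℝ} (hx0 : 0 ≤ x) (hx1 : x ≤ 1) :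
    Tendsto (fun n : ℕ => ((n : ℝ) + 1 + x) ^ 2 *
      (densityRatio x n 1 - 1 - ratioCoeffOne x 1 / (n + 1 + x))) atTop
      (𝓝 (ratioCoeffTwo x 1)) := by
  rw [tendsto_iff_norm_sub_tendsto_zero]
  have hN : Tendsto (fun n : ℕ => 100 / ((n : ℝ) + 1 + x)) atTop (𝓝 0) := by
    simp_rw [add_assoc]
    exact (tendsto_natCast_add _).const_div_atTop 100
  refine squeeze_zero' (Eventually.of_forall fun _ => norm_nonneg _) ?_ hN
  filter_upwards [eventually_ge_atTop 10] with n hn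
  have hpos : (0 : ℝ) < n + 1 + x := by positivity
  have h := abs_densityRatio_sub_le hx0 hx1 zero_le_one le_rfl hn
  rw [Real.norm_eq_abs]
  calc _ = |((n : ℝ) + 1 + x) ^ 2 * (densityRatio x n 1 - 1 - ratioCoeffOne x 1 / (n + 1 + x)
        - ratioCoeffTwo x 1 / (n + 1 + x) ^ 2)| := by
        congr 1; field_simp
    _ ≤ ((n : ℝ) + 1 + x) ^ 2 * (100 / ((n : ℝ) + 1 + x) ^ 3) := by
        rw [abs_mul, abs_of_pos (by positivity : 0 < ((n : ℝ) + 1 + x) ^ 2)]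
        gcongr
    _ = 100 / ((n : ℝ) + 1 + x) := by field_simp

lemma tendsto_integral_densityRatio {x : ℝ} (hx0 : 0 ≤ x) (hx1 : x ≤ 1) :
    Tendsto (fun n : ℕ => ((n : ℝ) + 1 + x) ^ 2 *
      ((∫ t in (0 : ℝ)..1, densityRatio x n t) - 1
        - (∫ t in (0 : ℝ)..1, ratioCoeffOne x t) / (n + 1 + x))) atTop
      (𝓝 (∫ t in (0 : ℝ)..1, ratioCoeffTwo x t)) := by
  rw [tendsto_iff_norm_sub_tendsto_zero]
  have hN : Tendsto (fun n : ℕ => 100 / ((n : ℝ) + 1 + x)) atTop (𝓝 0) := by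
    simp_rw [add_assoc]
    exact (tendsto_natCast_add _).const_div_atTop 100
  refine squeeze_zero' (Eventually.of_forall fun _ => norm_nonneg _) ?_ hN
  filter_upwards [eventually_ge_atTop 10] with n hn
  have hpos : (0 : ℝ) < n + 1 + x := by positivity
  have c1 : Continuous (ratioCoeffOne x) := by unfold ratioCoeffOne; fun_prop
  have c2 : Continuous (ratioCoeffTwo x) := by unfold ratioCoeffTwo; fun_prop
  have c0 := continuous_densityRatio x n
  have h := intervalIntegral.norm_integral_le_of_norm_le_const (a := (0 : ℝ)) (b := 1)
    (f := fun t => densityRatio x n t - 1 - ratioCoeffOne x t / (n + 1 + x)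
      - ratioCoeffTwo x t / (n + 1 + x) ^ 2) (C := 100 / ((n : ℝ) + 1 + x) ^ 3)
    (fun t ht => by
      rw [Set.uIoc_of_le zero_le_one] at ht
      exact abs_densityRatio_sub_le hx0 hx1 ht.1.le ht.2 hn)
  rw [intervalIntegral.integral_sub
    (Continuous.intervalIntegrable (by fun_prop) _ _)
    (Continuous.intervalIntegrable (by fun_prop) _ _),
    intervalIntegral.integral_sub (Continuous.intervalIntegrable (by fun_prop) _ _)
    (Continuous.intervalIntegrable (by fun_prop) _ _),
    intervalIntegral.integral_sub (Continuous.intervalIntegrable (by fun_prop) _ _)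
    (Continuous.intervalIntegrable (by fun_prop) _ _),
    intervalIntegral.integral_div, intervalIntegral.integral_div] at h
  simp only [intervalIntegral.integral_const, sub_zero, abs_one, mul_one, smul_eq_mul,
    Real.norm_eq_abs] at h
  rw [Real.norm_eq_abs]
  calc _ = |((n : ℝ) + 1 + x) ^ 2 * ((∫ t in (0 : ℝ)..1, densityRatio x n t) - 1
        - (∫ t in (0 : ℝ)..1, ratioCoeffOne x t) / (n + 1 + x)
        - (∫ t in (0 : ℝ)..1, ratioCoeffTwo x t) / (n + 1 + x) ^ 2)| := by
        congr 1; field_simp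
    _ ≤ ((n : ℝ) + 1 + x) ^ 2 * (100 / ((n : ℝ) + 1 + x) ^ 3) := by
        rw [abs_mul, abs_of_pos (by positivity : 0 < ((n : ℝ) + 1 + x) ^ 2)]
        gcongr
    _ = 100 / ((n : ℝ) + 1 + x) := by field_simp

lemma integral_ratioCoeffOne (x : ℝ) :
    ∫ t in (0 : ℝ)..1, ratioCoeffOne x t = 1 / 3 - x / 2 := by
  have h : ∀ t, ratioCoeffOne x t = -x + ((1 + x) * t ^ 1 + (-1 / 2) * t ^ 2) := by
    intro t; rw [ratioCoeffOne]; ring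
  simp only [h]
  rw [intervalIntegral.integral_add (Continuous.intervalIntegrable (by fun_prop) _ _)
    (Continuous.intervalIntegrable (by fun_prop) _ _),
    intervalIntegral.integral_add (Continuous.intervalIntegrable (by fun_prop) _ _)
    (Continuous.intervalIntegrable (by fun_prop) _ _)]
  simp only [intervalIntegral.integral_const_mul, intervalIntegral.integral_const,
    integral_pow, smul_eq_mul]
  norm_num
  ring

lemma integral_ratioCoeffTwo (x : ℝ) :
    ∫ t in (0 : ℝ)..1, ratioCoeffTwo x t = 3 / 20 + x / 24 - x ^ 2 / 3 := by
  have h : ∀ t, ratioCoeffTwo x t = (-(x * (1 + x))) * t ^ 1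
      + (((1 + x) / 2 + (1 + x) ^ 2 / 2 + x / 2) * t ^ 2
      + ((-1 / 3 - (1 + x) / 2) * t ^ 3 + 1 / 8 * t ^ 4)) := by
    intro t; rw [ratioCoeffTwo]; ring
  simp only [h]
  rw [intervalIntegral.integral_add (Continuous.intervalIntegrable (by fun_prop) _ _)
    (Continuous.intervalIntegrable (by fun_prop) _ _),
    intervalIntegral.integral_add (Continuous.intervalIntegrable (by fun_prop) _ _)
    (Continuous.intervalIntegrable (by fun_prop) _ _),
    intervalIntegral.integral_add (Continuous.intervalIntegrable (by fun_prop) _ _)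
    (Continuous.intervalIntegrable (by fun_prop) _ _)]
  simp only [intervalIntegral.integral_const_mul, integral_pow]
  norm_num
  ring

/-- The distribution function of `Z_{n+x}` near its median, with `q = 2/3 - x + b/(n+y)`
interpolating between the two neighbouring values of the Poisson distribution function. -/
noncomputable def interpolatedCDF (x b y : ℝ) (n : ℕ) : ℝ :=
  poissonCDF n (n + x) - (2 / 3 - x + b / (n + y)) * (g n (n + x) / n.factorial)

lemma g_div_factorial_ratio {x : ℝ} (hx : 0 ≤ x) (n : ℕ) (t : ℝ) :
    ((n + 1).factorial : ℝ) / g (n + 1) (n + 1 + x) * (g n (n + 1 + x - t) / n.factorial) =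
      densityRatio x n t := by
  have hN : (0 : ℝ) < n + 1 + x := by positivity
  have hfac : (n.factorial : ℝ) ≠ 0 := by positivity
  have hsub : (n : ℝ) + 1 + x - t = (n + 1 + x) * (1 - t / (n + 1 + x)) := by field_simp
  have hexp : Real.exp (-(n + 1 + x - t)) = Real.exp (-(n + 1 + x)) * Real.exp t := by
    rw [← Real.exp_add]; congr 1; ring
  rw [g, g, densityRatio, hexp, hsub, mul_pow, Nat.factorial_succ]
  push_cast
  field_simp
  ring

lemma interpolatedCDF_succ_sub {x : ℝ} (hx : 0 ≤ x) (b y : ℝ) (n : ℕ) :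
    ((n + 1).factorial : ℝ) / g (n + 1) (n + 1 + x) *
        (interpolatedCDF x b y (n + 1) - interpolatedCDF x b y n) =
      1 - (∫ t in (0 : ℝ)..1, densityRatio x n t) - (2 / 3 - x + b / (n + 1 + y))
        + (2 / 3 - x + b / (n + y)) * densityRatio x n 1 := by
  have hN : (0 : ℝ) < n + 1 + x := by positivity
  have hg : g (n + 1) (n + 1 + x) ≠ 0 := by unfold g; positivity
  have hfac : ((n + 1).factorial : ℝ) ≠ 0 := by positivity
  have hint : (∫ t in (0 : ℝ)..1, densityRatio x n t) =
      ((n + 1).factorial : ℝ) / g (n + 1) (n + 1 + x) *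
        (poissonCDF n (n + x) - poissonCDF n (n + 1 + x)) := by
    have h := intervalIntegral.integral_comp_sub_left (a := 0) (b := 1) (g n) ((n : ℝ) + 1 + x)
    rw [sub_zero, show (n : ℝ) + 1 + x - 1 = n + x by ring] at h
    rw [poissonCDF_sub, ← h, ← intervalIntegral.integral_div,
      ← intervalIntegral.integral_const_mul]
    simp only [g_div_factorial_ratio hx]
  have hone := g_div_factorial_ratio hx n 1
  rw [show (n : ℝ) + 1 + x - 1 = n + x by ring] at hone
  have hunit : ((n + 1).factorial : ℝ) / g (n + 1) (n + 1 + x) *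
      (g (n + 1) (n + 1 + x) / (n + 1).factorial) = 1 := by field_simp
  rw [hint, ← hone, interpolatedCDF, interpolatedCDF]
  push_cast
  rw [poissonCDF_succ]
  linear_combination (1 - (2 / 3 - x + b / (n + 1 + y))) * hunit

lemma tendsto_interpolatedCDF {x : ℝ} (hx : 0 ≤ x) (b y : ℝ) :
    Tendsto (interpolatedCDF x b y) atTop (𝓝 (1 / 2)) := by
  have hq : Tendsto (fun n : ℕ => 2 / 3 - x + b / (n + y)) atTop (𝓝 (2 / 3 - x)) := by
    simpa using ((tendsto_natCast_add y).const_div_atTop b).const_add (2 / 3 - x)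
  have hp : Tendsto (fun n : ℕ => g n (n + x) / n.factorial) atTop (𝓝 0) := by
    refine squeeze_zero (fun n => by unfold g; positivity) (fun n => ?_) tendsto_g_div_factorial
    gcongr
    exact g_le_self n (by positivity)
  simpa [interpolatedCDF] using! (tendsto_poissonCDF_add hx).sub (hq.mul hp)

lemma tendsto_interpolatedCDF_succ_sub {x : ℝ} (hx0 : 0 ≤ x) (hx1 : x ≤ 1) (b : ℝ) {y : ℝ}
    (hy : 0 ≤ y) :
    Tendsto (fun n : ℕ => ((n : ℝ) + 1 + x) ^ 2 *
      (((n + 1).factorial : ℝ) / g (n + 1) (n + 1 + x) *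
        (interpolatedCDF x b y (n + 1) - interpolatedCDF x b y n))) atTop
      (𝓝 (3 / 2 * (b + (x ^ 2 * (x - 1) / 3 + 4 / 135)))) := by
  have hinv : ∀ z : ℝ, Tendsto (fun n : ℕ => 1 / ((n : ℝ) + z)) atTop (𝓝 0) := fun z =>
    (tendsto_natCast_add z).const_div_atTop 1
  have hfirst : Tendsto (fun n : ℕ => ((n : ℝ) + 1 + x) * (b / (n + y))) atTop (𝓝 b) := by
    have h : Tendsto (fun n : ℕ => b + b * (1 + x - y) * (1 / ((n : ℝ) + y))) atTop (𝓝 b) := by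
      simpa using ((hinv y).const_mul (b * (1 + x - y))).const_add b
    refine h.congr' ?_
    filter_upwards [eventually_gt_atTop 0] with n hn
    have : (0 : ℝ) < n := by exact_mod_cast hn
    field_simp
    ring
  have hsecond : Tendsto (fun n : ℕ => ((n : ℝ) + 1 + x) ^ 2 *
      (b / (n + y) - b / (n + 1 + y))) atTop (𝓝 b) := by
    have h : Tendsto (fun n : ℕ => ((n : ℝ) + 1 + x) * (b / (n + y)) *
        (1 + (x - y) * (1 / ((n : ℝ) + (1 + y))))) atTop (𝓝 b) := by
      simpa using hfirst.mul (((hinv (1 + y)).const_mul (x - y)).const_add 1)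
    refine h.congr' ?_
    filter_upwards [eventually_gt_atTop 0] with n hn
    have : (0 : ℝ) < n := by exact_mod_cast hn
    field_simp
    ring
  have hq : Tendsto (fun n : ℕ => 2 / 3 - x + b / (n + y)) atTop (𝓝 (2 / 3 - x)) := by
    simpa using ((tendsto_natCast_add y).const_div_atTop b).const_add (2 / 3 - x)
  have h := (((hq.mul (tendsto_densityRatio_one hx0 hx1)).sub
    (tendsto_integral_densityRatio hx0 hx1)).add hsecond).add (hfirst.mul_const (1 / 2))
  convert! h.congr' ?_ using 2
  · rw [integral_ratioCoeffTwo, ratioCoeffTwo]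
    ring
  · filter_upwards with n
    have hN : (0 : ℝ) < n + 1 + x := by positivity
    rw [interpolatedCDF_succ_sub hx0, integral_ratioCoeffOne, ratioCoeffOne]
    field_simp
    ring

lemma normalizingFactor_pos {x : ℝ} (hx : 0 ≤ x) (n : ℕ) :
    0 < ((n : ℝ) + 1 + x) ^ 2 * (((n + 1).factorial : ℝ) / g (n + 1) (n + 1 + x)) := by
  have hg : 0 < g (n + 1) (n + 1 + x) := by unfold g; positivity
  positivity

lemma lt_of_tendsto_of_lt_succ {u : ℕ → ℝ} {l : ℝ} (hu : Tendsto u atTop (𝓝 l))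
    (h : ∀ᶠ n in atTop, u n < u (n + 1)) : ∀ᶠ n in atTop, u n < l := by
  obtain ⟨N, hN⟩ := eventually_atTop.1 h
  filter_upwards [eventually_ge_atTop N] with n hn
  have hmono : StrictMono fun k => u (n + k) :=
    strictMono_nat_of_lt_succ fun k => hN (n + k) (by omega)
  have hlim : Tendsto (fun k => u (n + k)) atTop (𝓝 l) := by
    simpa [add_comm] using (tendsto_add_atTop_iff_nat n).2 hu
  exact (hmono zero_lt_one).trans_le (hmono.monotone.ge_of_tendsto hlim 1)

lemma eventually_interpolatedCDF_lt {x b y : ℝ} (hx0 : 0 ≤ x) (hx1 : x ≤ 1) (hy : 0 ≤ y)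
    (hb : 0 < b + (x ^ 2 * (x - 1) / 3 + 4 / 135)) :
    ∀ᶠ n in atTop, interpolatedCDF x b y n < 1 / 2 := by
  apply lt_of_tendsto_of_lt_succ (tendsto_interpolatedCDF hx0 b y)
  filter_upwards [(tendsto_interpolatedCDF_succ_sub hx0 hx1 b hy).eventually_const_lt
    (by positivity : 0 < 3 / 2 * (b + (x ^ 2 * (x - 1) / 3 + 4 / 135)))] with n hn
  rw [← mul_assoc] at hn
  exact sub_pos.1 (pos_of_mul_pos_right hn (normalizingFactor_pos hx0 n).le)

lemma eventually_lt_interpolatedCDF {x b y : ℝ} (hx0 : 0 ≤ x) (hx1 : x ≤ 1) (hy : 0 ≤ y)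
    (hb : b + (x ^ 2 * (x - 1) / 3 + 4 / 135) < 0) :
    ∀ᶠ n in atTop, 1 / 2 < interpolatedCDF x b y n := by
  have h := lt_of_tendsto_of_lt_succ (tendsto_interpolatedCDF hx0 b y).neg (by
    filter_upwards [(tendsto_interpolatedCDF_succ_sub hx0 hx1 b hy).eventually_lt_const
      (by linarith : 3 / 2 * (b + (x ^ 2 * (x - 1) / 3 + 4 / 135)) < 0)] with n hn
    rw [← mul_assoc] at hn
    exact neg_lt_neg (sub_neg.1 (neg_of_mul_neg_right hn (normalizingFactor_pos hx0 n).le)))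
  filter_upwards [h] with n hn
  exact neg_lt_neg_iff.1 hn

lemma sum_range_poisson (n : ℕ) (l : ℝ) :
    ∑ k ∈ Finset.range n, Real.exp (-l) * l ^ k / k.factorial =
      poissonCDF n l - g n l / n.factorial := by
  rw [poissonCDF, Finset.sum_range_succ, mul_add, Finset.mul_sum, g]
  simp only [mul_div_assoc]
  ring

lemma eventually_zMeasure_Iic_eq {x k : ℝ} (hx0 : 0 ≤ x) (hx1 : x < 1)
    (hk : x = 2 / 3 → k ≤ 0) :
    ∃ b y : ℝ, 0 ≤ y ∧ b + (x ^ 2 * (x - 1) / 3 + 4 / 135) = Hfun x - k ∧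
      ∀ᶠ n : ℕ in atTop, zMeasure (n + x) (Set.Iic (n + x + (1 / 3 + k / (n + x)))) =
        ENNReal.ofReal (interpolatedCDF x b y n) := by
  have hkn : Tendsto (fun n : ℕ => k / ((n : ℝ) + x)) atTop (𝓝 0) :=
    (tendsto_natCast_add x).const_div_atTop k
  by_cases hx : x ≤ 2 / 3
  · refine ⟨-k, x, hx0, by rw [Hfun, if_pos hx]; ring, ?_⟩
    have hle : ∀ᶠ n : ℕ in atTop, x + 1 / 3 + k / (n + x) ≤ 1 := by
      rcases hx.eq_or_lt with h | h
      · filter_upwards with n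
        have : k / ((n : ℝ) + x) ≤ 0 := div_nonpos_of_nonpos_of_nonneg (hk h) (by positivity)
        linarith
      · filter_upwards [hkn.eventually_lt_const (sub_pos.2 h)] with n hn
        linarith
    filter_upwards [hle, hkn.eventually_const_lt (by norm_num : (-(1 / 3) : ℝ) < 0)]
      with n hn hn'
    rw [show (n : ℝ) + x + (1 / 3 + k / (n + x)) = n + (x + 1 / 3 + k / (n + x)) by ring,
      zMeasure_Iic_s4 (by positivity) n (by linarith) hn, sum_range_poisson, interpolatedCDF, g]
    congr 1
    ring
  · have hx' : 2 / 3 < x := not_le.1 hx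
    refine ⟨(2 / 3 - x) * (x - 1) - k, 1, zero_le_one, by rw [Hfun, if_neg hx]; ring, ?_⟩
    filter_upwards [hkn.eventually_const_lt (by linarith : 2 / 3 - x < 0),
      hkn.eventually_lt_const (by norm_num : (0 : ℝ) < 1 / 3)] with n hn hn'
    have hN : (0 : ℝ) < n + x := by positivity
    rw [show (n : ℝ) + x + (1 / 3 + k / (n + x)) = (n + 1 : ℕ) + (x - 2 / 3 + k / (n + x)) by
        push_cast; ring,
      zMeasure_Iic_s4 hN.le (n + 1) (by linarith) (by linarith), sum_range_poisson,
      poissonCDF_succ, interpolatedCDF, g, g, Nat.factorial_succ]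
    congr 1
    have : (n.factorial : ℝ) ≠ 0 := by positivity
    push_cast
    field_simp
    ring

lemma Hfun_two_thirds_le : Hfun (2 / 3) ≤ -(1 / 100) := by
  norm_num [Hfun]

theorem prop1 (x : ℝ) (hx : x ∈ Set.Ico (0 : ℝ) 1) (ε : ℝ) (hε : 0 < ε) :
    ∃ n₀ : ℕ, ∀ n : ℕ, n₀ ≤ n →
      (Hfun x - ε) / (n + x) ≤ medianZ (n + x) - (n + x) - 1 / 3 ∧
      medianZ (n + x) - (n + x) - 1 / 3 ≤ (Hfun x + ε) / (n + x) := by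
  obtain ⟨hx0, hx1⟩ := hx
  obtain ⟨η, hη0, hηε, hη⟩ : ∃ η : ℝ, 0 < η ∧ η ≤ ε ∧ η ≤ 1 / 100 :=
    ⟨min ε (1 / 100), by positivity, min_le_left _ _, min_le_right _ _⟩
  obtain ⟨b₁, y₁, hy₁, hb₁, h₁⟩ := eventually_zMeasure_Iic_eq (k := Hfun x - η) hx0 hx1
    (by rintro rfl; linarith [Hfun_two_thirds_le])
  obtain ⟨b₂, y₂, hy₂, hb₂, h₂⟩ := eventually_zMeasure_Iic_eq (k := Hfun x + η) hx0 hx1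
    (by rintro rfl; linarith [Hfun_two_thirds_le])
  have hhalf : (1 : ℝ≥0∞) / 2 = ENNReal.ofReal (1 / 2) := by
    rw [ENNReal.ofReal_div_of_pos two_pos]; simp
  have hpos : 0 < b₁ + (x ^ 2 * (x - 1) / 3 + 4 / 135) := by linarith
  have hneg : b₂ + (x ^ 2 * (x - 1) / 3 + 4 / 135) < 0 := by linarith
  refine eventually_atTop.1 ?_
  filter_upwards [h₁, h₂, eventually_interpolatedCDF_lt hx0 hx1.le hy₁ hpos,
    eventually_lt_interpolatedCDF hx0 hx1.le hy₂ hneg] with n h₁ h₂ hlt hgt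
  have hmed := medianZ_mem_Icc
    (h₁.trans_lt (hhalf ▸ (ENNReal.ofReal_lt_ofReal_iff (by norm_num)).2 hlt))
    ((hhalf ▸ ENNReal.ofReal_le_ofReal hgt.le : (1 : ℝ≥0∞) / 2 ≤ _).trans_eq h₂.symm)
  have hlow : (Hfun x - ε) / (n + x) ≤ (Hfun x - η) / (n + x) := by gcongr
  have hupp : (Hfun x + η) / (n + x) ≤ (Hfun x + ε) / (n + x) := by gcongr
  constructor
  · linarith [hmed.1]
  · linarith [hmed.2]
end
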